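/- Let R be a commutative Noetherian local ring of Krull dimension d with maximal ideal 𝔪, C a semidualizing R-module, and M, N finitely generated R-modules with N in the Auslander class A_C(R) and N maximal Cohen-Macaulay. Suppose that Hom_R(M,N) is nonzero and has finite C-injective dimension, and that Ext_R^i(M,N) = 0 for all 1 ≤ i ≤ d−1. Then R is Cohen-Macaulay, N has finite C-injective dimension, and M ≅ Γ_𝔪(M) ⊕ R^r for some integer r ≥ 0. -/

import Mathlib

open CategoryTheory

noncomputable section

/-- The `i`-th Ext module of two `R`-modules. -/
def extMod (R : Type) [CommRing R] (i : ℕ) (M N : Type) [AddCommGroup M] [Module R M]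
    [AddCommGroup N] [Module R N] : ModuleCat R :=
  ((Ext R (ModuleCat R) i).obj (Opposite.op (ModuleCat.of R M))).obj (ModuleCat.of R N)

/-- The `i`-th Tor module of two `R`-modules. -/
def torMod (R : Type) [CommRing R] (i : ℕ) (M N : Type) [AddCommGroup M] [Module R M]
    [AddCommGroup N] [Module R N] : ModuleCat R :=
  ((Tor (ModuleCat R) i).obj (ModuleCat.of R M)).obj (ModuleCat.of R N)

/-- The depth of a module over a local ring: the infimum of the set of
indices `i` with `Ext^i(R/𝔪, N) ≠ 0`. -/
def moduleDepth (R : Type) [CommRing R] [IsLocalRing R] (N : Type) [AddCommGroup N]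
    [Module R N] : ℕ :=
  sInf {i : ℕ | ¬ Subsingleton (extMod R i (R ⧸ IsLocalRing.maximalIdeal R) N)}

/-- An `R`-module `N` has finite injective dimension iff there is an `n` such that
`Ext^i(M, N) = 0` for all modules `M` and all `i > n`. -/
def HasFiniteInjDim (R : Type) [CommRing R] (N : Type) [AddCommGroup N] [Module R N] : Prop :=
  ∃ n : ℕ, ∀ (M : Type) [AddCommGroup M] [Module R M], ∀ i : ℕ, n < i →
    Subsingleton (extMod R i M N)

/-- An `R`-module `M` has finite projective dimension iff there is an `n` such that
`Ext^i(M, N) = 0` for all modules `N` and all `i > n`. -/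
def HasFiniteProjDim (R : Type) [CommRing R] (M : Type) [AddCommGroup M] [Module R M] : Prop :=
  ∃ n : ℕ, ∀ (N : Type) [AddCommGroup N] [Module R N], ∀ i : ℕ, n < i →
    Subsingleton (extMod R i M N)

/-- The `𝔪`-torsion submodule `Γ_𝔪(M)` of a module over a local ring. -/
def mTorsion (R : Type) [CommRing R] [IsLocalRing R] (M : Type) [AddCommGroup M]
    [Module R M] : Submodule R M :=
  ⨆ n : ℕ, Submodule.torsionBySet R M ((IsLocalRing.maximalIdeal R ^ n : Ideal R) : Set R)

/-- A semidualizing module: the natural map `R → Hom(C,C)` is bijective and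
`Ext^i(C,C) = 0` for all `i ≥ 1`. -/
structure IsSemidualizing (R : Type) [CommRing R] (C : Type) [AddCommGroup C]
    [Module R C] : Prop where
  bijective : Function.Bijective (LinearMap.lsmul R C)
  ext_vanish : ∀ i : ℕ, 1 ≤ i → Subsingleton (extMod R i C C)

/-- Membership in the Auslander class `A_C(R)`: the natural map `M → Hom(C, C ⊗ M)` is
bijective, `Tor_i(C, M) = 0` and `Ext^i(C, C ⊗ M) = 0` for all `i ≥ 1`. -/
structure MemAuslanderClass (R : Type) [CommRing R] (C : Type) [AddCommGroup C] [Module R C]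
    (M : Type) [AddCommGroup M] [Module R M] : Prop where
  bijective : Function.Bijective ((TensorProduct.mk R C M).flip)
  tor_vanish : ∀ i : ℕ, 1 ≤ i → Subsingleton (torMod R i C M)
  ext_vanish : ∀ i : ℕ, 1 ≤ i → Subsingleton (extMod R i C (TensorProduct R C M))

/-- A module `N` is Tor-rigid if for every finitely generated module `M` and every `i ≥ 1`,
`Tor_i(M, N) = 0` implies `Tor_{i+1}(M, N) = 0`. -/
def IsTorRigid (R : Type) [CommRing R] (N : Type) [AddCommGroup N] [Module R N] : Prop :=
  ∀ (M : Type) [AddCommGroup M] [Module R M], Module.Finite R M →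
    ∀ i : ℕ, 1 ≤ i → Subsingleton (torMod R i M N) → Subsingleton (torMod R (i + 1) M N)

/-- The natural map `C ⊗ Hom(M,N) → Hom(M, C ⊗ N)`, sending `c ⊗ φ` to `m ↦ c ⊗ φ m`. -/
def homTensorMap (R : Type) [CommRing R] (C M N : Type) [AddCommGroup C] [Module R C]
    [AddCommGroup M] [Module R M] [AddCommGroup N] [Module R N] :
    TensorProduct R C (M →ₗ[R] N) →ₗ[R] (M →ₗ[R] TensorProduct R C N) :=
  TensorProduct.lift
    ((LinearMap.llcomp R M N (TensorProduct R C N)).comp (TensorProduct.mk R C N))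

section ExtVanishing

variable {R : Type} [CommRing R]

/-- `Ext^i(M, N) = 0`. -/
def ExtVanish (R : Type) [CommRing R] (M N : Type) [AddCommGroup M] [Module R M]
    [AddCommGroup N] [Module R N] (i : ℕ) : Prop :=
  Subsingleton (Abelian.Ext (ModuleCat.of R M) (ModuleCat.of R N) i)

/-- `0 → A → B → C → 0` is a short exact sequence. -/
structure IsShortExact {A B C : Type} [AddCommGroup A] [Module R A] [AddCommGroup B] [Module R B]
    [AddCommGroup C] [Module R C] (f : A →ₗ[R] B) (g : B →ₗ[R] C) : Prop where
  inj : Function.Injective f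
  surj : Function.Surjective g
  exact : Function.Exact f g

variable {A B C : Type} [AddCommGroup A] [Module R A] [AddCommGroup B] [Module R B]
  [AddCommGroup C] [Module R C] {M N T : Type} [AddCommGroup M] [Module R M]
  [AddCommGroup N] [Module R N] [AddCommGroup T] [Module R T]
  {f : A →ₗ[R] B} {g : B →ₗ[R] C}

namespace IsShortExact

/-- The short complex of modules attached to a short exact sequence. -/
abbrev complex (h : IsShortExact f g) : ShortComplex (ModuleCat R) :=
  ShortComplex.moduleCatMk f g h.exact.linearMap_comp_eq_zero

lemma shortExact (h : IsShortExact f g) : h.complex.ShortExact where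
  exact := (ShortComplex.ShortExact.moduleCat_exact_iff_function_exact _).mpr h.exact
  mono_f := (ModuleCat.mono_iff_injective _).mpr h.inj
  epi_g := (ModuleCat.epi_iff_surjective _).mpr h.surj

/-- The class of a short exact sequence of modules in `Ext¹`. -/
def extClass (h : IsShortExact f g) : Abelian.Ext (ModuleCat.of R C) (ModuleCat.of R A) 1 :=
  h.shortExact.extClass

lemma covariant_one (h : IsShortExact f g) {i : ℕ}
    (x : Abelian.Ext (ModuleCat.of R M) (ModuleCat.of R A) (i + 1))
    (hx : x.comp (Abelian.Ext.mk₀ (ModuleCat.ofHom f)) (add_zero _) = 0) :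
    ∃ y : Abelian.Ext (ModuleCat.of R M) (ModuleCat.of R C) i, y.comp h.extClass rfl = x :=
  Abelian.Ext.covariant_sequence_exact₁ (ModuleCat.of R M) h.shortExact x hx rfl

lemma covariant_two (h : IsShortExact f g) {i : ℕ}
    (x : Abelian.Ext (ModuleCat.of R M) (ModuleCat.of R B) i)
    (hx : x.comp (Abelian.Ext.mk₀ (ModuleCat.ofHom g)) (add_zero _) = 0) :
    ∃ y : Abelian.Ext (ModuleCat.of R M) (ModuleCat.of R A) i,
      y.comp (Abelian.Ext.mk₀ (ModuleCat.ofHom f)) (add_zero _) = x :=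
  Abelian.Ext.covariant_sequence_exact₂ (ModuleCat.of R M) h.shortExact x hx

lemma covariant_three (h : IsShortExact f g) {i : ℕ}
    (x : Abelian.Ext (ModuleCat.of R M) (ModuleCat.of R C) i)
    (hx : x.comp h.extClass rfl = 0) :
    ∃ y : Abelian.Ext (ModuleCat.of R M) (ModuleCat.of R B) i,
      y.comp (Abelian.Ext.mk₀ (ModuleCat.ofHom g)) (add_zero _) = x :=
  Abelian.Ext.covariant_sequence_exact₃ (ModuleCat.of R M) h.shortExact x rfl hx

lemma contravariant_one (h : IsShortExact f g) {i : ℕ}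
    (x : Abelian.Ext (ModuleCat.of R A) (ModuleCat.of R T) i)
    (hx : h.extClass.comp x (add_comm 1 i) = 0) :
    ∃ y : Abelian.Ext (ModuleCat.of R B) (ModuleCat.of R T) i,
      (Abelian.Ext.mk₀ (ModuleCat.ofHom f)).comp y (zero_add i) = x :=
  Abelian.Ext.contravariant_sequence_exact₁ h.shortExact (ModuleCat.of R T) x (add_comm 1 i) hx

lemma contravariant_two (h : IsShortExact f g) {i : ℕ}
    (x : Abelian.Ext (ModuleCat.of R B) (ModuleCat.of R T) i)
    (hx : (Abelian.Ext.mk₀ (ModuleCat.ofHom f)).comp x (zero_add i) = 0) :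
    ∃ y : Abelian.Ext (ModuleCat.of R C) (ModuleCat.of R T) i,
      (Abelian.Ext.mk₀ (ModuleCat.ofHom g)).comp y (zero_add i) = x :=
  Abelian.Ext.contravariant_sequence_exact₂ h.shortExact (ModuleCat.of R T) x hx

lemma contravariant_three (h : IsShortExact f g) {i : ℕ}
    (x : Abelian.Ext (ModuleCat.of R C) (ModuleCat.of R T) (i + 1))
    (hx : (Abelian.Ext.mk₀ (ModuleCat.ofHom g)).comp x (zero_add (i + 1)) = 0) :
    ∃ y : Abelian.Ext (ModuleCat.of R A) (ModuleCat.of R T) i,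
      h.extClass.comp y (add_comm 1 i) = x :=
  Abelian.Ext.contravariant_sequence_exact₃ h.shortExact (ModuleCat.of R T) x hx (add_comm 1 i)

lemma extVanish_cov_two (h : IsShortExact f g) (i : ℕ) (h1 : ExtVanish R M A i)
    (h3 : ExtVanish R M C i) : ExtVanish R M B i := by
  refine subsingleton_of_forall_eq 0 fun x => ?_
  obtain ⟨y, rfl⟩ := h.covariant_two x (h3.elim _ _)
  rw [h1.elim y 0, Abelian.Ext.zero_comp]

lemma extVanish_cov_one (h : IsShortExact f g) (i : ℕ) (h3 : ExtVanish R M C i)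
    (h2 : ExtVanish R M B (i + 1)) : ExtVanish R M A (i + 1) := by
  refine subsingleton_of_forall_eq 0 fun x => ?_
  obtain ⟨y, rfl⟩ := h.covariant_one x (h2.elim _ _)
  rw [h3.elim y 0, Abelian.Ext.zero_comp]

lemma extVanish_cov_three (h : IsShortExact f g) (i : ℕ) (h2 : ExtVanish R M B i)
    (h1 : ExtVanish R M A (i + 1)) : ExtVanish R M C i := by
  refine subsingleton_of_forall_eq 0 fun x => ?_
  obtain ⟨y, rfl⟩ := h.covariant_three x (h1.elim _ _)
  rw [h2.elim y 0, Abelian.Ext.zero_comp]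

lemma extVanish_contra_two (h : IsShortExact f g) (i : ℕ) (h1 : ExtVanish R A T i)
    (h3 : ExtVanish R C T i) : ExtVanish R B T i := by
  refine subsingleton_of_forall_eq 0 fun x => ?_
  obtain ⟨y, rfl⟩ := h.contravariant_two x (h1.elim _ _)
  rw [h3.elim y 0, Abelian.Ext.comp_zero]

lemma extVanish_contra_three (h : IsShortExact f g) (i : ℕ) (h1 : ExtVanish R A T i)
    (h2 : ExtVanish R B T (i + 1)) : ExtVanish R C T (i + 1) := by
  refine subsingleton_of_forall_eq 0 fun x => ?_
  obtain ⟨y, rfl⟩ := h.contravariant_three x (h2.elim _ _)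
  rw [h1.elim y 0, Abelian.Ext.comp_zero]

lemma extVanish_contra_one (h : IsShortExact f g) (i : ℕ) (h2 : ExtVanish R B T i)
    (h3 : ExtVanish R C T (i + 1)) : ExtVanish R A T i := by
  refine subsingleton_of_forall_eq 0 fun x => ?_
  obtain ⟨y, rfl⟩ := h.contravariant_one x (h3.elim _ _)
  rw [h2.elim y 0, Abelian.Ext.comp_zero]

/-- Homomorphisms extend along `A → B` if `Ext¹(C, T) = 0`. -/
lemma exists_extension (h : IsShortExact f g) (h3 : ExtVanish R C T 1) (φ : A →ₗ[R] T) :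
    ∃ ψ : B →ₗ[R] T, ψ ∘ₗ f = φ := by
  obtain ⟨y, hy⟩ := h.contravariant_one
    (Abelian.Ext.mk₀ (ModuleCat.ofHom φ)) (h3.elim _ _)
  obtain ⟨ψ, rfl⟩ := (Abelian.Ext.mk₀_bijective _ _).2 y
  refine ⟨ψ.hom, ?_⟩
  rw [Abelian.Ext.mk₀_comp_mk₀] at hy
  exact congrArg ModuleCat.Hom.hom ((Abelian.Ext.mk₀_bijective _ _).1 hy)

/-- Homomorphisms lift along `B → C` if `Ext¹(M, A) = 0`. -/
lemma exists_lift (h : IsShortExact f g) (h3 : ExtVanish R M A 1) (φ : M →ₗ[R] C) :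
    ∃ ψ : M →ₗ[R] B, g ∘ₗ ψ = φ := by
  obtain ⟨y, hy⟩ := h.covariant_three (Abelian.Ext.mk₀ (ModuleCat.ofHom φ)) (h3.elim _ _)
  obtain ⟨ψ, rfl⟩ := (Abelian.Ext.mk₀_bijective _ _).2 y
  refine ⟨ψ.hom, ?_⟩
  rw [Abelian.Ext.mk₀_comp_mk₀] at hy
  exact congrArg ModuleCat.Hom.hom ((Abelian.Ext.mk₀_bijective _ _).1 hy)

/-- `0 → Hom(M, A) → Hom(M, B) → Hom(M, C) → 0` is exact if `Ext¹(M, A) = 0`. -/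
lemma llcomp (h : IsShortExact f g) (h1 : ExtVanish R M A 1) :
    IsShortExact (f.compRight R (M := M)) (g.compRight R (M := M)) where
  inj a b hab := by
    ext m
    exact h.inj (LinearMap.congr_fun hab m)
  surj φ := h.exists_lift h1 φ
  exact φ := by
    constructor
    · intro hφ
      have : ∀ m, ∃ a, f a = φ m := fun m => (h.exact _).1 (LinearMap.congr_fun hφ m)
      let e := LinearEquiv.ofInjective f h.inj
      refine ⟨e.symm.toLinearMap ∘ₗ φ.codRestrict (LinearMap.range f) this, ?_⟩
      ext m
      exact congrArg Subtype.val (e.apply_symm_apply ⟨φ m, this m⟩)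
    · rintro ⟨ψ, rfl⟩
      ext m
      exact h.exact.apply_apply_eq_zero _

/-- `0 → Hom(C, T) → Hom(B, T) → Hom(A, T)` is exact. -/
lemma exact_lcomp (h : IsShortExact f g) : Function.Exact (g.lcomp R T) (f.lcomp R T) := by
  intro φ
  constructor
  · intro hφ
    have hk : LinearMap.ker g ≤ LinearMap.ker φ := fun b hb => by
      obtain ⟨a, rfl⟩ := (h.exact b).1 hb
      exact LinearMap.congr_fun hφ a
    let e := g.quotKerEquivOfSurjective h.surj
    refine ⟨(LinearMap.ker g).liftQ φ hk ∘ₗ e.symm.toLinearMap, ?_⟩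
    ext b
    have : e.symm (g b) = (LinearMap.ker g).mkQ b := by
      rw [LinearEquiv.symm_apply_eq]; rfl
    simp [this]
  · rintro ⟨ψ, rfl⟩
    ext m
    change ψ (g (f m)) = 0
    rw [h.exact.apply_apply_eq_zero, map_zero]

/-- `0 → Hom(C, T) → Hom(B, T) → Hom(A, T) → 0` is exact if `Ext¹(C, T) = 0`. -/
lemma lcomp (h : IsShortExact f g) (h1 : ExtVanish R C T 1) :
    IsShortExact (g.lcomp R T) (f.lcomp R T) where
  inj a b hab := by
    ext m
    obtain ⟨m, rfl⟩ := h.surj m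
    exact LinearMap.congr_fun hab m
  surj φ := h.exists_extension h1 φ
  exact := h.exact_lcomp

lemma mkQ_ker_subtype (f : M →ₗ[R] N) (hf : Function.Surjective f) :
    IsShortExact (LinearMap.ker f).subtype f :=
  ⟨Subtype.val_injective, hf, LinearMap.exact_subtype_ker_map f⟩

lemma mkQ_range (f : M →ₗ[R] N) (hf : Function.Injective f) :
    IsShortExact f (LinearMap.range f).mkQ :=
  ⟨hf, Submodule.mkQ_surjective _, LinearMap.exact_map_mkQ_range f⟩

lemma inl_snd : IsShortExact (LinearMap.inl R M N) (LinearMap.snd R M N) :=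
  ⟨LinearMap.inl_injective, LinearMap.snd_surjective, .inl_snd⟩

end IsShortExact

lemma extVanish_zero_iff : ExtVanish R M N 0 ↔ Subsingleton (M →ₗ[R] N) := by
  refine (Equiv.subsingleton_congr ?_)
  exact Abelian.Ext.addEquiv₀.toEquiv.trans (ModuleCat.homEquiv)

lemma extVanish_of_projective [Module.Projective R M] (i : ℕ) : ExtVanish R M N (i + 1) :=
  subsingleton_of_forall_eq 0 fun x =>
    haveI : Projective (ModuleCat.of R M) := (IsProjective.iff_projective M).1 inferInstance
    Abelian.Ext.eq_zero_of_projective x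

lemma extVanish_of_subsingleton_right [Subsingleton N] (i : ℕ) : ExtVanish R M N i := by
  refine subsingleton_of_forall_eq 0 fun x => ?_
  rw [← Abelian.Ext.comp_mk₀_id x]
  have : 𝟙 (ModuleCat.of R N) = 0 := by ext; exact Subsingleton.elim _ _
  rw [this, Abelian.Ext.mk₀_zero, Abelian.Ext.comp_zero]

lemma extVanish_of_subsingleton_left [Subsingleton M] (i : ℕ) : ExtVanish R M N i := by
  refine subsingleton_of_forall_eq 0 fun x => ?_
  rw [← Abelian.Ext.mk₀_id_comp x]
  have : 𝟙 (ModuleCat.of R M) = 0 := by ext; exact Subsingleton.elim _ _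
  rw [this, Abelian.Ext.mk₀_zero, Abelian.Ext.zero_comp]

/-- A retract of a module in the second variable. -/
lemma ExtVanish.retract_right {i : ℕ} (hB : ExtVanish R M B i) (s : A →ₗ[R] B) (r : B →ₗ[R] A)
    (h : r ∘ₗ s = LinearMap.id) : ExtVanish R M A i := by
  refine subsingleton_of_forall_eq 0 fun x => ?_
  have h' : ModuleCat.ofHom s ≫ ModuleCat.ofHom r = 𝟙 (ModuleCat.of R A) := by
    rw [← ModuleCat.ofHom_comp, h]; rfl
  rw [← Abelian.Ext.comp_mk₀_id x, ← h', ← Abelian.Ext.mk₀_comp_mk₀,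
    ← Abelian.Ext.comp_assoc_of_third_deg_zero, hB.elim (x.comp _ _) 0, Abelian.Ext.zero_comp]

/-- A retract of a module in the first variable. -/
lemma ExtVanish.retract_left {i : ℕ} (hB : ExtVanish R B N i) (s : A →ₗ[R] B) (r : B →ₗ[R] A)
    (h : r ∘ₗ s = LinearMap.id) : ExtVanish R A N i := by
  refine subsingleton_of_forall_eq 0 fun x => ?_
  have h' : ModuleCat.ofHom s ≫ ModuleCat.ofHom r = 𝟙 (ModuleCat.of R A) := by
    rw [← ModuleCat.ofHom_comp, h]; rfl
  rw [← Abelian.Ext.mk₀_id_comp x, ← h', ← Abelian.Ext.mk₀_comp_mk₀,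
    Abelian.Ext.comp_assoc (a₂₃ := i) (a₁₂ := 0) (a₁ := 0) (a₂ := 0) (a₃ := i) _ _ _ (by simp) (by simp) (by simp),
    hB.elim ((Abelian.Ext.mk₀ _).comp x _) 0, Abelian.Ext.comp_zero]

lemma ExtVanish.of_equiv_right {i : ℕ} (hB : ExtVanish R M B i) (e : A ≃ₗ[R] B) :
    ExtVanish R M A i :=
  hB.retract_right e.toLinearMap e.symm.toLinearMap (by ext; simp)

lemma ExtVanish.of_equiv_left {i : ℕ} (hB : ExtVanish R B N i) (e : A ≃ₗ[R] B) :
    ExtVanish R A N i :=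
  hB.retract_left e.toLinearMap e.symm.toLinearMap (by ext; simp)

lemma ExtVanish.prod_right {i : ℕ} (hA : ExtVanish R M A i) (hB : ExtVanish R M B i) :
    ExtVanish R M (A × B) i :=
  IsShortExact.inl_snd.extVanish_cov_two i hA hB

lemma ExtVanish.pi_right {i : ℕ} (hA : ExtVanish R M A i) : ∀ b : ℕ,
    ExtVanish R M (Fin b → A) i
  | 0 => extVanish_of_subsingleton_right i
  | b + 1 => (hA.prod_right (hA.pi_right b)).of_equiv_right
      (Fin.consLinearEquiv R (fun _ : Fin (b + 1) => A)).symm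

lemma mk₀_lsmul (x : R) : Abelian.Ext.mk₀ (ModuleCat.ofHom (LinearMap.lsmul R A x)) =
    x • Abelian.Ext.mk₀ (𝟙 (ModuleCat.of R A)) := by
  rw [← Abelian.Ext.mk₀_smul]; rfl

/-- Nakayama's lemma for Ext in the first variable. -/
lemma ExtVanish.of_quotient_left [IsNoetherianRing R] [IsLocalRing R] [Module.Finite R A]
    [Module.Finite R T] {x : R} (hx : x ∈ IsLocalRing.maximalIdeal R)
    {g : A →ₗ[R] C} (h : IsShortExact (LinearMap.lsmul R A x) g) {i : ℕ}
    (hC : ExtVanish R C T (i + 1)) : ExtVanish R A T i := by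
  have hfin : Module.Finite R (Abelian.Ext (ModuleCat.of R A) (ModuleCat.of R T) i) :=
    inferInstance
  have key : ∀ y : Abelian.Ext (ModuleCat.of R A) (ModuleCat.of R T) i, ∃ z, x • z = y := by
    intro y
    obtain ⟨z, hz⟩ := h.contravariant_one y (hC.elim _ _)
    refine ⟨z, ?_⟩
    rw [← hz]
    rw [mk₀_lsmul, Abelian.Ext.smul_comp, Abelian.Ext.mk₀_id_comp]
  have htop : (⊤ : Submodule R (Abelian.Ext (ModuleCat.of R A) (ModuleCat.of R T) i)) = ⊥ := by
    refine Submodule.eq_bot_of_le_smul_of_le_jacobson_bot (IsLocalRing.maximalIdeal R) _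
      (Module.finite_def.1 hfin) ?_ (IsLocalRing.maximalIdeal_le_jacobson _)
    intro y _
    obtain ⟨z, rfl⟩ := key y
    exact Submodule.smul_mem_smul hx trivial
  exact subsingleton_of_forall_eq 0 fun y => by
    simpa [htop] using (Submodule.mem_top : y ∈ (⊤ : Submodule R _))

/-- If `x` kills `M` and is regular on `A`, Ext into `A / x` shifts to Ext into `A`. -/
lemma comp_mk₀_lsmul_eq_zero {x : R} (hM : ∀ m : M, x • m = 0) {i : ℕ}
    (y : Abelian.Ext (ModuleCat.of R M) (ModuleCat.of R A) i) :
    y.comp (Abelian.Ext.mk₀ (ModuleCat.ofHom (LinearMap.lsmul R A x))) (add_zero _) = 0 := by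
  rw [mk₀_lsmul, Abelian.Ext.comp_smul, Abelian.Ext.comp_mk₀_id]
  have h0 : x • 𝟙 (ModuleCat.of R M) = 0 := by
    ext m; exact hM m
  rw [← Abelian.Ext.mk₀_id_comp y, ← Abelian.Ext.smul_comp, ← Abelian.Ext.mk₀_smul, h0,
    Abelian.Ext.mk₀_zero, Abelian.Ext.zero_comp]

lemma ExtVanish.succ_of_smul_eq_zero {x : R} (hM : ∀ m : M, x • m = 0)
    {g : A →ₗ[R] C} (h : IsShortExact (LinearMap.lsmul R A x) g) {i : ℕ}
    (hC : ExtVanish R M C i) : ExtVanish R M A (i + 1) := by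
  refine subsingleton_of_forall_eq 0 fun y => ?_
  obtain ⟨z, rfl⟩ := h.covariant_one y (comp_mk₀_lsmul_eq_zero hM y)
  rw [hC.elim z 0, Abelian.Ext.zero_comp]

lemma extVanish_zero_of_smul_eq_zero {x : R} (hM : ∀ m : M, x • m = 0)
    (hA : IsSMulRegular A x) : ExtVanish R M A 0 := by
  refine extVanish_zero_iff.2 (subsingleton_of_forall_eq 0 fun φ => ?_)
  ext m
  refine hA ?_
  simp [← map_smul, hM]

end ExtVanishing

section ExtComparison

variable {R : Type} [CommRing R] {M N : Type} [AddCommGroup M] [Module R M]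
  [AddCommGroup N] [Module R N]

lemma subsingleton_homology_linearYonedaObj_iff {X : ModuleCat R} (P : ProjectiveResolution X)
    (Y : ModuleCat R) (i j : ℕ) (hj : (ComplexShape.up ℕ).prev i = j) :
    Subsingleton ((P.complex.linearYonedaObj R Y).homology i) ↔
      ∀ f : P.complex.X i ⟶ Y, P.complex.d (i + 1) i ≫ f = 0 →
        ∃ g : P.complex.X j ⟶ Y, P.complex.d i j ≫ g = f := by
  rw [← ModuleCat.isZero_iff_subsingleton, ← HomologicalComplex.exactAt_iff_isZero_homology,
    HomologicalComplex.exactAt_iff' _ j i (i + 1) hj (by simp),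
    ShortComplex.moduleCat_exact_iff]
  rfl

lemma subsingleton_extMod_zero_iff :
    Subsingleton (extMod R 0 M N) ↔ Subsingleton (M →ₗ[R] N) := by
  let P := projectiveResolution (ModuleCat.of R M)
  have e := P.isoExt (R := R) 0 (ModuleCat.of R N)
  rw [show Subsingleton (extMod R 0 M N) ↔ _ from
    Equiv.subsingleton_congr e.toLinearEquiv.toEquiv,
    subsingleton_homology_linearYonedaObj_iff P _ 0 0 (by simp)]
  constructor
  · intro h
    refine subsingleton_of_forall_eq 0 fun φ => ?_
    let π : P.complex.X 0 ⟶ ModuleCat.of R M := P.π.f 0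
    have hπ : P.complex.d (0 + 1) 0 ≫ π = 0 := P.complex_d_comp_π_f_zero
    obtain ⟨g, hg⟩ := h (π ≫ ModuleCat.ofHom φ) (by
      rw [reassoc_of% hπ, Limits.zero_comp])
    rw [P.complex.shape _ _ (by simp), Limits.zero_comp] at hg
    have : (ModuleCat.ofHom φ : ModuleCat.of R M ⟶ ModuleCat.of R N) = 0 := by
      have h2 : Epi π := inferInstanceAs (Epi (P.π.f 0))
      exact (cancel_epi (P.π.f 0)).1 (hg.symm.trans Limits.comp_zero.symm)
    exact congrArg ModuleCat.Hom.hom this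
  · intro h f hf
    have hM : ∀ g : (ModuleCat.of R M ⟶ ModuleCat.of R N), g = 0 := fun g => by
      ext x; exact LinearMap.congr_fun (Subsingleton.elim g.hom 0) x
    refine ⟨0, ?_⟩
    rw [Limits.comp_zero, ← P.exact₀.g_desc f hf]
    have : P.exact₀.desc f hf = 0 := hM _
    rw [this, Limits.comp_zero]

lemma subsingleton_extMod_iff (i : ℕ) :
    Subsingleton (extMod R i M N) ↔ ExtVanish R M N i := by
  obtain _ | i := i
  · rw [subsingleton_extMod_zero_iff, extVanish_zero_iff]
  let P := projectiveResolution (ModuleCat.of R M)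
  have e := P.isoExt (R := R) (i + 1) (ModuleCat.of R N)
  rw [show Subsingleton (extMod R (i + 1) M N) ↔ _ from
    Equiv.subsingleton_congr e.toLinearEquiv.toEquiv,
    subsingleton_homology_linearYonedaObj_iff P _ (i + 1) i (by simp)]
  constructor
  · intro h
    refine subsingleton_of_forall_eq 0 fun x => ?_
    obtain ⟨f, hf, rfl⟩ := P.extMk_surjective x (i + 1 + 1) rfl
    exact (P.extMk_eq_zero_iff f _ rfl hf i rfl).2 (h f hf)
  · intro h f hf
    exact (P.extMk_eq_zero_iff f _ rfl hf i rfl).1 (h.elim _ _)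

end ExtComparison

section Depth

open IsLocalRing Pointwise

variable {R : Type} [CommRing R] {A B C M N T : Type} [AddCommGroup A] [Module R A]
  [AddCommGroup B] [Module R B] [AddCommGroup C] [Module R C] [AddCommGroup M] [Module R M]
  [AddCommGroup N] [Module R N] [AddCommGroup T] [Module R T] {f : A →ₗ[R] B} {g : B →ₗ[R] C}

lemma IsShortExact.quotSMulTop {x : R} (hx : IsSMulRegular A x) :
    IsShortExact (LinearMap.lsmul R A x) (x • (⊤ : Submodule R A)).mkQ :=
  ⟨hx, Submodule.mkQ_surjective _, LinearMap.exact_lsmul_mkQ_smul_top A x⟩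

/-- A finitely generated module without nonzero homomorphisms from a faithful one is zero. -/
lemma subsingleton_of_subsingleton_hom [IsNoetherianRing R] [Module.Finite R C]
    [Module.Finite R A] (hC : Module.annihilator R C = ⊥) (h : Subsingleton (C →ₗ[R] A)) :
    Subsingleton A := by
  obtain ⟨r, hr, hreg⟩ := IsSMulRegular.subsingleton_linearMap_iff.1 h
  rw [hC, Submodule.mem_bot] at hr
  subst hr
  exact ⟨fun a b => hreg (by simp)⟩

section

variable [IsLocalRing R]

/-- `Ext^i(R/𝔪, N) = 0` for all `i < s`. -/
def DepthGE (R : Type) [CommRing R] [IsLocalRing R] (s : ℕ) (N : Type) [AddCommGroup N]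
    [Module R N] : Prop :=
  ∀ i < s, ExtVanish R (R ⧸ maximalIdeal R) N i

namespace DepthGE

lemma mono {s t : ℕ} (h : DepthGE R t N) (hst : s ≤ t) : DepthGE R s N :=
  fun i hi => h i (hi.trans_le hst)

lemma zero : DepthGE R 0 N := fun _ hi => absurd hi (Nat.not_lt_zero _)

lemma of_equiv {s : ℕ} (h : DepthGE R s B) (e : A ≃ₗ[R] B) : DepthGE R s A :=
  fun i hi => (h i hi).of_equiv_right e

lemma pi {s : ℕ} (h : DepthGE R s A) (b : ℕ) : DepthGE R s (Fin b → A) :=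
  fun i hi => (h i hi).pi_right b

lemma of_injective (h : DepthGE R 1 B) {φ : A →ₗ[R] B} (hφ : Function.Injective φ) :
    DepthGE R 1 A := by
  intro i hi
  obtain rfl : i = 0 := by omega
  have := extVanish_zero_iff.1 (h 0 one_pos)
  refine extVanish_zero_iff.2 (subsingleton_of_forall_eq 0 fun ψ => ?_)
  refine LinearMap.ext fun x => hφ ?_
  simpa using LinearMap.congr_fun (Subsingleton.elim (φ ∘ₗ ψ) 0) x

lemma left {s : ℕ} (h : IsShortExact f g) (hB : DepthGE R (s + 1) B) (hC : DepthGE R s C) :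
    DepthGE R (s + 1) A := by
  rintro (_ | i) hi
  · exact (hB.mono (by omega)).of_injective h.inj 0 one_pos
  · exact h.extVanish_cov_one i (hC i (by omega)) (hB _ hi)

lemma right {s : ℕ} (h : IsShortExact f g) (hA : DepthGE R (s + 1) A) (hB : DepthGE R s B) :
    DepthGE R s C :=
  fun i hi => h.extVanish_cov_three i (hB i hi) (hA _ (by omega))

lemma of_quotient {s : ℕ} {x : R} (hx : x ∈ maximalIdeal R) {g : A →ₗ[R] C}
    (h : IsShortExact (LinearMap.lsmul R A x) g) (hC : DepthGE R s C) : DepthGE R (s + 1) A := by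
  have hk : ∀ m : R ⧸ maximalIdeal R, x • m = 0 := by
    intro m
    obtain ⟨m, rfl⟩ := Ideal.Quotient.mk_surjective m
    exact Ideal.Quotient.eq_zero_iff_mem.2 (Ideal.mul_mem_right _ _ hx)
  rintro (_ | i) hi
  · exact extVanish_zero_of_smul_eq_zero hk h.inj
  · exact ExtVanish.succ_of_smul_eq_zero hk h (hC i (by omega))

variable [IsNoetherianRing R]

lemma exists_regular [Module.Finite R A] {s : ℕ} (h : DepthGE R (s + 1) A) :
    ∃ x ∈ maximalIdeal R, IsSMulRegular A x := by
  have := extVanish_zero_iff.1 (h 0 (by omega))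
  simpa [Ideal.annihilator_quotient] using IsSMulRegular.subsingleton_linearMap_iff.1 this

lemma le_supportDim {s : ℕ} : ∀ {A : Type} [AddCommGroup A] [Module R A] [Module.Finite R A]
    [Nontrivial A], DepthGE R s A → (s : WithBot ℕ∞) ≤ Module.supportDim R A := by
  induction s with
  | zero =>
    intro A _ _ _ _ _
    have := Module.supportDim_ne_bot_of_nontrivial R A
    obtain ⟨n, hn⟩ := WithBot.ne_bot_iff_exists.1 this
    rw [← hn]
    exact WithBot.coe_le_coe.2 zero_le
  | succ s ih =>
    intro A _ _ _ _ h
    obtain ⟨x, hx, hr⟩ := h.exists_regular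
    rw [← Module.supportDim_quotSMulTop_succ_eq_supportDim hr hx]
    have := nontrivial_quotSMulTop_of_mem_maximalIdeal A hx
    have := ih (DepthGE.right (.quotSMulTop hr) h (h.mono (by omega)))
    push_cast
    gcongr

end DepthGE

lemma depthGE_of_moduleDepth_eq {d : ℕ} (h : moduleDepth R N = d) : DepthGE R d N := by
  intro i hi
  by_contra hcon
  rw [← subsingleton_extMod_iff] at hcon
  exact Nat.notMem_of_lt_sInf (h ▸ hi) hcon

lemma moduleDepth_eq_of_depthGE {d : ℕ} (h : DepthGE R d N)
    (h' : ¬ ExtVanish R (R ⧸ maximalIdeal R) N d) : moduleDepth R N = d := by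
  refine le_antisymm (Nat.sInf_le ?_) (le_csInf ⟨d, ?_⟩ fun i hi => ?_)
  · rwa [Set.mem_ofPred, subsingleton_extMod_iff]
  · rwa [Set.mem_ofPred, subsingleton_extMod_iff]
  · rw [Set.mem_ofPred, subsingleton_extMod_iff] at hi
    by_contra hlt
    exact hi (h i (by omega))

variable [IsNoetherianRing R]

lemma exists_depthGE_not_extVanish {d : ℕ} (hd : ringKrullDim R = d) :
    ∃ t ≤ d, DepthGE R t R ∧ ¬ ExtVanish R (R ⧸ maximalIdeal R) R t := by
  classical
  have hex : ∃ t, ¬ ExtVanish R (R ⧸ maximalIdeal R) R t := by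
    by_contra! hcon
    have h := DepthGE.le_supportDim (A := R) (s := d + 1) fun i _ => hcon i
    rw [Module.supportDim_self_eq_ringKrullDim, hd] at h
    have : d + 1 ≤ d := by exact_mod_cast h
    omega
  have hD : DepthGE R (Nat.find hex) R := fun i hi => not_not.1 (Nat.find_min hex hi)
  refine ⟨Nat.find hex, ?_, hD, Nat.find_spec hex⟩
  have h := hD.le_supportDim
  rw [Module.supportDim_self_eq_ringKrullDim, hd] at h
  exact_mod_cast h

/-- `Ext^j(B, T) = 0` for all finitely generated `B` and all `j > n`. -/
def InjDimLE (R : Type) [CommRing R] (n : ℕ) (T : Type) [AddCommGroup T] [Module R T] : Prop :=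
  ∀ (B : Type) [AddCommGroup B] [Module R B], Module.Finite R B → ∀ j, n < j → ExtVanish R B T j

lemma exists_finite_extVanish_not_extVanish_zero {s : ℕ} : ∀ {p : ℕ} {A : Type} [AddCommGroup A]
    [Module R A] [Module.Finite R A],
    (∀ (T : Type) [AddCommGroup T] [Module R T], ∀ j > p, ExtVanish R A T j) →
    DepthGE R s A → ¬ ExtVanish R (R ⧸ maximalIdeal R) A s →
    ∃ (A' : Type) (_ : AddCommGroup A') (_ : Module R A'), Module.Finite R A' ∧
      (∀ (T : Type) [AddCommGroup T] [Module R T], ∀ j > p + s, ExtVanish R A' T j) ∧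
      ¬ ExtVanish R (R ⧸ maximalIdeal R) A' 0 := by
  induction s with
  | zero => exact fun hp _ h0 => ⟨_, _, _, inferInstance, hp, h0⟩
  | succ s ih =>
    intro p A _ _ _ hp hD h0
    obtain ⟨x, hx, hr⟩ := hD.exists_regular
    have hse := IsShortExact.quotSMulTop hr
    obtain ⟨A', i1, i2, hf, hA', hzero⟩ := ih (p := p + 1) (A := QuotSMulTop x A)
      (fun T _ _ j hj => by
        obtain ⟨j, rfl⟩ := Nat.exists_eq_add_of_lt (Nat.zero_lt_of_lt hj)
        rw [zero_add] at hj ⊢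
        exact hse.extVanish_contra_three j (hp T j (by omega)) (hp T _ (by omega)))
      (DepthGE.right hse hD (hD.mono (by omega)))
      (fun hcon => h0 (ExtVanish.succ_of_smul_eq_zero (fun m => by
        obtain ⟨m, rfl⟩ := Ideal.Quotient.mk_surjective m
        exact Ideal.Quotient.eq_zero_iff_mem.2 (Ideal.mul_mem_right _ _ hx)) hse hcon))
    exact ⟨A', i1, i2, hf, fun T _ _ j hj => hA' T j (by omega), hzero⟩

/-- If `Ext^n(k, T)` and all `Ext^{n+1}(-, T)` vanish, then so does `Ext^n(-, T)`. -/
lemma extVanish_of_residueField [Module.Finite R T] {n : ℕ}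
    (hn : ∀ (B : Type) [AddCommGroup B] [Module R B], Module.Finite R B → ExtVanish R B T (n + 1))
    (hk : ExtVanish R (R ⧸ maximalIdeal R) T n) [Module.Finite R B] : ExtVanish R B T n := by
  induction ‹Module.Finite R B› using
    IsNoetherianRing.induction_on_isQuotientEquivQuotientPrime R with
  | subsingleton N => exact extVanish_of_subsingleton_left n
  | quotient N p e =>
    refine ExtVanish.of_equiv_left ?_ e
    by_cases hpm : p.1 = maximalIdeal R
    · rwa [hpm]
    · have hlt : ¬ maximalIdeal R ≤ p.1 := fun hle =>
        hpm (le_antisymm (le_maximalIdeal p.2.ne_top) hle)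
      obtain ⟨x, hx, hxp⟩ := SetLike.not_le_iff_exists.1 hlt
      have hr : IsSMulRegular (R ⧸ p.1) x := by
        intro a b hab
        have hx0 : Ideal.Quotient.mk p.1 x ≠ 0 := by
          rwa [Ne, Ideal.Quotient.eq_zero_iff_mem]
        exact mul_left_cancel₀ hx0 hab
      exact ExtVanish.of_quotient_left hx (.quotSMulTop hr) (hn _ inferInstance)
  | exact N₁ N₂ N₃ f g hf hg hfg h₁ h₃ =>
    exact IsShortExact.extVanish_contra_two ⟨hf, hg, hfg⟩ n h₁ h₃

/-- The injective dimension of a finitely generated module, if finite, is at most the depth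
of the ring. -/
lemma InjDimLE.le_depth [Module.Finite R T] {n t : ℕ} (h : InjDimLE R n T)
    (ht : DepthGE R t R) (ht' : ¬ ExtVanish R (R ⧸ maximalIdeal R) R t) : InjDimLE R t T := by
  classical
  have hex : ∃ n, InjDimLE R n T := ⟨n, h⟩
  obtain hle | hlt := le_or_gt (Nat.find hex) t
  · exact fun B _ _ hB j hj => Nat.find_spec hex B hB j (by omega)
  obtain ⟨m, hm⟩ := Nat.exists_eq_add_of_lt hlt
  have hspec := Nat.find_spec hex
  refine absurd ?_ (Nat.find_min hex (m := t + m) (by omega))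
  rw [hm] at hspec
  intro B _ _ hB j hj
  obtain hj | rfl : t + m + 1 < j ∨ j = t + m + 1 := by omega
  · exact hspec B hB j hj
  refine extVanish_of_residueField (fun B _ _ hB => hspec B hB _ (by omega)) ?_
  obtain ⟨A, _, _, hA, hAT, hA0⟩ := exists_finite_extVanish_not_extVanish_zero (R := R) (p := 0)
    (A := R) (fun T _ _ j hj => by
      obtain ⟨j, rfl⟩ := Nat.exists_eq_add_of_lt hj
      exact extVanish_of_projective _) ht ht'
  rw [extVanish_zero_iff, not_subsingleton_iff_nontrivial] at hA0
  obtain ⟨φ, hφ⟩ := exists_ne (0 : (R ⧸ maximalIdeal R) →ₗ[R] A)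
  have : IsSimpleModule R (R ⧸ maximalIdeal R) :=
    isSimpleModule_iff_isCoatom.2 (maximalIdeal.isMaximal R).out
  have hinj := φ.injective_or_eq_zero.resolve_right hφ
  exact (IsShortExact.mkQ_range φ hinj).extVanish_contra_one _ (hAT T _ (by omega))
    (hspec _ inferInstance _ (by omega))

lemma InjDimLE.extVanish_of_depthGE [Module.Finite R T] {n : ℕ} (h : InjDimLE R n T) {s : ℕ} :
    ∀ {Z : Type} [AddCommGroup Z] [Module R Z] [Module.Finite R Z], DepthGE R s Z →
    ∀ i, n < i + s → ExtVanish R Z T i := by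
  induction s with
  | zero => exact fun _ i hi => h _ inferInstance i hi
  | succ s ih =>
    intro Z _ _ _ hD i hi
    obtain ⟨x, hx, hr⟩ := hD.exists_regular
    have hse := IsShortExact.quotSMulTop hr
    exact ExtVanish.of_quotient_left hx hse
      (ih (DepthGE.right hse hD (hD.mono (by omega))) (i + 1) (by omega))

lemma DepthGE.of_hom [Module.Finite R C] (hC : Module.annihilator R C = ⊥) {s : ℕ} :
    ∀ {A : Type} [AddCommGroup A] [Module R A] [Module.Finite R A],
    (∀ i, ExtVanish R C A (i + 1)) → DepthGE R s (C →ₗ[R] A) → DepthGE R s A := by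
  induction s with
  | zero => exact fun _ _ => DepthGE.zero
  | succ s ih =>
    intro A _ _ _ hV hD
    obtain ⟨x, hx, hr⟩ := hD.exists_regular
    have hrA : IsSMulRegular A x := by
      have hs : Subsingleton (C →ₗ[R] LinearMap.ker (LinearMap.lsmul R A x)) := by
        refine subsingleton_of_forall_eq 0 fun φ => ?_
        have : (LinearMap.ker (LinearMap.lsmul R A x)).subtype ∘ₗ φ = 0 := by
          refine hr ?_
          ext c
          exact (LinearMap.mem_ker.1 (φ c).2).trans (smul_zero x).symm
        ext c
        simpa using LinearMap.congr_fun this c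
      have := subsingleton_of_subsingleton_hom hC hs
      exact LinearMap.ker_eq_bot.1 ((Submodule.subsingleton_iff_eq_bot).1 this)
    have hse := IsShortExact.quotSMulTop hrA
    have hh : IsShortExact (LinearMap.lsmul R (C →ₗ[R] A) x) _ := hse.llcomp (hV 0)
    refine DepthGE.of_quotient hx hse (ih (fun i => ?_) ?_)
    · exact hse.extVanish_cov_three _ (hV i) (hV _)
    · exact DepthGE.right hh hD (hD.mono (by omega))

end

end Depth

section DepthHom

variable {R : Type} [CommRing R] {M N F : Type} [AddCommGroup M] [Module R M] [AddCommGroup N]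
  [Module R N] [AddCommGroup F] [Module R F]

/-- `Hom(R^b, N) ≅ N^b`. -/
def homFinEquiv (R : Type) [CommRing R] (N : Type) [AddCommGroup N] [Module R N] (b : ℕ) :
    ((Fin b → R) →ₗ[R] N) ≃ₗ[R] (Fin b → N) :=
  ((Pi.basisFun R (Fin b)).constr R).symm

lemma extVanish_ker [Module.Projective R F] {π : F →ₗ[R] M} (hπ : Function.Surjective π) {i : ℕ}
    (h : ExtVanish R M N (i + 2)) : ExtVanish R (LinearMap.ker π) N (i + 1) :=
  (IsShortExact.mkQ_ker_subtype π hπ).extVanish_contra_one (i + 1) (extVanish_of_projective i) h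

lemma lcomp_injective {π : F →ₗ[R] M} (hπ : Function.Surjective π) :
    Function.Injective (π.lcomp R N) := fun φ ψ h => by
  ext m
  obtain ⟨m, rfl⟩ := hπ m
  exact LinearMap.congr_fun h m

variable [IsLocalRing R]

lemma depthGE_cokernel_of_depthGE_hom [Module.Projective R F] {π : F →ₗ[R] M}
    (hπ : Function.Surjective π) {s : ℕ}
    (hK : DepthGE R s (LinearMap.ker π →ₗ[R] N))
    (hV : ∀ i, 1 ≤ i → i + 1 ≤ s → ExtVanish R M N i) :
    DepthGE R s (((F →ₗ[R] N)) ⧸ LinearMap.range (π.lcomp R N)) := by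
  obtain _ | _ | s := s
  · exact DepthGE.zero
  · have hle : LinearMap.range (π.lcomp R N) =
        LinearMap.ker ((LinearMap.ker π).subtype.lcomp R N) :=
      ((IsShortExact.mkQ_ker_subtype π hπ).exact_lcomp (T := N)).linearMap_ker_eq.symm
    refine hK.of_injective (φ := (LinearMap.range (π.lcomp R N)).liftQ
      ((LinearMap.ker π).subtype.lcomp R N) hle.le) ?_
    rw [← LinearMap.ker_eq_bot, Submodule.ker_liftQ_eq_bot]
    exact hle.ge
  · have h := (IsShortExact.mkQ_ker_subtype π hπ).lcomp (T := N) (hV 1 le_rfl (by omega))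
    exact hK.of_equiv ((Submodule.quotEquivOfEq _ _ h.exact.linearMap_ker_eq.symm).trans
      (((LinearMap.ker π).subtype.lcomp R N).quotKerEquivOfSurjective h.surj))

variable [IsNoetherianRing R]

lemma DepthGE.hom {s : ℕ} (hN : DepthGE R s N) : ∀ {M : Type} [AddCommGroup M] [Module R M]
    [Module.Finite R M], (∀ i, 1 ≤ i → i + 2 ≤ s → ExtVanish R M N i) →
    DepthGE R s (M →ₗ[R] N) := by
  induction s with
  | zero => exact fun _ => DepthGE.zero
  | succ s ih =>
    intro M _ _ _ hV
    obtain ⟨b, π, hπ⟩ := Module.Finite.exists_fin' R M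
    refine DepthGE.left (IsShortExact.mkQ_range _ (lcomp_injective (N := N) hπ))
      ((hN.pi b).of_equiv (homFinEquiv R N b)) ?_
    refine depthGE_cokernel_of_depthGE_hom hπ (ih (hN.mono (by omega)) fun i hi his => ?_)
      fun i hi his => hV i hi (by omega)
    obtain ⟨i, rfl⟩ := Nat.exists_eq_add_of_le' hi
    exact extVanish_ker hπ (hV _ (by omega) (by omega))

lemma DepthGE.cokernel_lcomp {s : ℕ} (hN : DepthGE R s N) [Module.Finite R F]
    [Module.Projective R F] {π : F →ₗ[R] M} (hπ : Function.Surjective π)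
    (hV : ∀ i, 1 ≤ i → i + 1 ≤ s → ExtVanish R M N i) :
    DepthGE R s (((F →ₗ[R] N)) ⧸ LinearMap.range (π.lcomp R N)) := by
  refine depthGE_cokernel_of_depthGE_hom hπ (hN.hom fun i hi his => ?_) hV
  obtain ⟨i, rfl⟩ := Nat.exists_eq_add_of_le' hi
  exact extVanish_ker hπ (hV _ (by omega) (by omega))

end DepthHom

section Unit

open IsLocalRing TensorProduct

variable {R : Type} [CommRing R] {A B C F H M N S T : Type} [AddCommGroup A] [Module R A]
  [AddCommGroup B] [Module R B] [AddCommGroup C] [Module R C] [AddCommGroup H] [Module R H]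
  [AddCommGroup M] [Module R M] [AddCommGroup N] [Module R N]
  [AddCommGroup S] [Module R S] [AddCommGroup T] [Module R T]

lemma exists_surjective_residueField [IsLocalRing R] [Module.Finite R A] [Nontrivial A] :
    ∃ φ : A →ₗ[R] R ⧸ maximalIdeal R, Function.Surjective φ := by
  obtain ⟨p, hp, -⟩ := (eq_top_or_exists_le_coatom (⊥ : Submodule R A)).resolve_left bot_ne_top
  have : IsSimpleModule R (A ⧸ p) := isSimpleModule_iff_isCoatom.2 hp
  obtain ⟨I, hI, ⟨e⟩⟩ := isSimpleModule_iff_quot_maximal.1 this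
  obtain rfl := eq_maximalIdeal hI
  exact ⟨e.toLinearMap ∘ₗ p.mkQ, e.surjective.comp p.mkQ_surjective⟩

lemma nontrivial_tensorProduct_of_isLocalRing [IsLocalRing R] [Module.Finite R A] [Nontrivial A]
    [Module.Finite R B] [Nontrivial B] : Nontrivial (A ⊗[R] B) := by
  obtain ⟨φ, hφ⟩ := exists_surjective_residueField (R := R) (A := A)
  obtain ⟨ψ, hψ⟩ := exists_surjective_residueField (R := R) (A := B)
  obtain ⟨a, ha⟩ := hφ 1
  obtain ⟨b, hb⟩ := hψ 1
  refine ⟨a ⊗ₜ b, 0, fun h => one_ne_zero (α := R ⧸ maximalIdeal R) ?_⟩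
  simpa [ha, hb] using congrArg
    (LinearMap.mul' R (R ⧸ maximalIdeal R) ∘ₗ TensorProduct.map φ ψ) h

/-- The unit map `H → Hom(C, C ⊗ H)`. -/
abbrev homUnit (R C H : Type) [CommRing R] [AddCommGroup C] [Module R C] [AddCommGroup H]
    [Module R H] : H →ₗ[R] C →ₗ[R] C ⊗[R] H :=
  (TensorProduct.mk R C H).flip

/-- The evaluation map `C ⊗ Hom(C, T) → T`. -/
def homCounit (R C T : Type) [CommRing R] [AddCommGroup C] [Module R C] [AddCommGroup T]
    [Module R T] : C ⊗[R] (C →ₗ[R] T) →ₗ[R] T :=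
  TensorProduct.lift LinearMap.applyₗ

lemma homCounit_tmul (c : C) (φ : C →ₗ[R] T) : homCounit R C T (c ⊗ₜ φ) = φ c := rfl

lemma homCounit_lTensor_homUnit (x : C ⊗[R] H) :
    homCounit R C (C ⊗[R] H) ((homUnit R C H).lTensor C x) = x := by
  induction x with
  | zero => simp
  | tmul c h => rfl
  | add x y hx hy => simp only [map_add, hx, hy]

lemma homUnit_hom_injective (hN : Function.Injective (homUnit R C N)) :
    Function.Injective (homUnit R C (M →ₗ[R] N)) := by
  refine (injective_iff_map_eq_zero _).2 fun h hh => ?_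
  ext m
  refine hN ?_
  ext c
  have := congrArg ((LinearMap.applyₗ (R := R) m).lTensor C) (LinearMap.congr_fun hh c)
  simpa using this

lemma exists_eq_sum_tmul {b : ℕ} {π : (Fin b → R) →ₗ[R] C} (hπ : Function.Surjective π)
    (x : C ⊗[R] H) : ∃ φ : Fin b → H, x = ∑ i, π (Pi.single i 1) ⊗ₜ φ i := by
  induction x with
  | zero => exact ⟨0, by simp⟩
  | tmul c h =>
    obtain ⟨v, rfl⟩ := hπ c
    refine ⟨fun i => v i • h, ?_⟩
    conv_lhs => rw [pi_eq_sum_univ' v, map_sum, TensorProduct.sum_tmul]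
    refine Finset.sum_congr rfl fun i _ => ?_
    rw [map_smul, TensorProduct.smul_tmul]
  | add x y hx hy =>
    obtain ⟨φ, rfl⟩ := hx
    obtain ⟨ψ, rfl⟩ := hy
    exact ⟨φ + ψ, by simp [TensorProduct.tmul_add, Finset.sum_add_distrib]⟩

lemma ExtVanish.pi_left {i : ℕ} (hA : ExtVanish R A M i) : ∀ b : ℕ,
    ExtVanish R (Fin b → A) M i
  | 0 => extVanish_of_subsingleton_left i
  | b + 1 => (IsShortExact.inl_snd.extVanish_contra_two i hA (hA.pi_left b)).of_equiv_left
      (Fin.consLinearEquiv R (fun _ : Fin (b + 1) => A)).symm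

variable [IsNoetherianRing R] [Module.Finite R C]

lemma extVanish_hom_of_injDimLE {t : ℕ} (hT : InjDimLE R t T)
    (hCT : ∀ i, ExtVanish R C T (i + 1)) (j : ℕ) :
    ∀ {S : Type} [AddCommGroup S] [Module R S] [Module.Finite R S],
      (∀ i, ExtVanish R S C (i + 1)) → ∀ i, t < i + 1 + j → ExtVanish R (S →ₗ[R] C) T (i + 1) := by
  induction j with
  | zero => exact fun _ i hi => hT _ inferInstance _ hi
  | succ j ih =>
    intro S _ _ _ hS i hi
    obtain ⟨b, π, hπ⟩ := Module.Finite.exists_fin' R S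
    have hse := (IsShortExact.mkQ_ker_subtype π hπ).lcomp (T := C) (hS 0)
    refine hse.extVanish_contra_one _ (((hCT i).pi_left b).of_equiv_left (homFinEquiv R C b))
      (ih (fun i => extVanish_ker hπ (hS _)) (i + 1) (by omega))

lemma homCounit_injective {t : ℕ} (hC : Function.Surjective (LinearMap.lsmul R C))
    (hCC : ∀ i, ExtVanish R C C (i + 1)) (hT : InjDimLE R t T)
    (hCT : ∀ i, ExtVanish R C T (i + 1)) : Function.Injective (homCounit R C T) := by
  refine (injective_iff_map_eq_zero _).2 fun x hx => ?_
  obtain ⟨b, π, hπ⟩ := Module.Finite.exists_fin' R C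
  obtain ⟨φ, rfl⟩ := exists_eq_sum_tmul hπ x
  obtain ⟨b', ρ, hρ⟩ := Module.Finite.exists_fin' R (LinearMap.ker π)
  simp only [map_sum, homCounit_tmul] at hx
  let Φ : ((Fin b → R) →ₗ[R] C) →ₗ[R] T :=
    ∑ i, φ i ∘ₗ LinearMap.applyₗ (R := R) (Pi.single i 1)
  have hΦ : Φ ∘ₗ π.lcomp R C = 0 := by
    ext h
    obtain ⟨r, rfl⟩ := hC h
    simpa [Φ, ← Finset.smul_sum] using congrArg (r • ·) hx
  have hse := (IsShortExact.mkQ_ker_subtype π hπ).lcomp (T := C) (hCC 0)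
  obtain ⟨Φ', hΦ'⟩ := (hse.exact_lcomp (T := T) Φ).1 hΦ
  have hse' := (IsShortExact.mkQ_ker_subtype ρ hρ).lcomp (T := C) (extVanish_ker hπ (hCC 1))
  obtain ⟨Ψ, hΨ⟩ := hse'.exists_extension (T := T)
    (extVanish_hom_of_injDimLE hT hCT t (fun i => extVanish_ker hρ
      (extVanish_ker hπ (hCC (i + 2)))) 0 (by omega)) Φ'
  let σ : ∀ {n : ℕ}, Fin n → C →ₗ[R] (Fin n → R) →ₗ[R] C := fun i =>
    LinearMap.smulRightₗ (LinearMap.proj i)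
  have hσ : ∀ {n : ℕ} (i : Fin n) c y, σ i c y = y i • c := fun i c y => rfl
  have hφ : ∀ i, φ i = ∑ j, (ρ (Pi.single j 1) : Fin b → R) i • (Ψ ∘ₗ σ j) := by
    intro i
    ext c
    have h1 : φ i c = Φ (σ i c) := by
      simp only [Φ, LinearMap.sum_apply, LinearMap.comp_apply, LinearMap.applyₗ_apply_apply, hσ]
      rw [Finset.sum_eq_single i]
      · simp
      · intro j _ hj
        simp [Pi.single_eq_of_ne hj.symm]
      · simp
    have h2 : Φ (σ i c) = Ψ (σ i c ∘ₗ (LinearMap.ker π).subtype ∘ₗ ρ) := by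
      rw [← hΦ', ← hΨ]; rfl
    have h3 : σ i c ∘ₗ (LinearMap.ker π).subtype ∘ₗ ρ =
        ∑ j, (ρ (Pi.single j 1) : Fin b → R) i • σ j c := by
      refine LinearMap.pi_ext' fun k => LinearMap.ext_ring ?_
      simp only [LinearMap.comp_apply, LinearMap.sum_apply, LinearMap.smul_apply, hσ,
        LinearMap.coe_single, Submodule.subtype_apply]
      rw [Finset.sum_eq_single k]
      · simp
      · intro j _ hj
        simp [Pi.single_eq_of_ne hj]
      · simp
    rw [h1, h2, h3]
    simp [LinearMap.sum_apply]
  have hρπ : ∀ j, ∑ i, (ρ (Pi.single j 1) : Fin b → R) i • π (Pi.single i 1) = 0 := by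
    intro j
    have h : π (ρ (Pi.single j 1) : Fin b → R) = 0 := (ρ (Pi.single j 1)).2
    rw [pi_eq_sum_univ' (ρ (Pi.single j 1) : Fin b → R), map_sum] at h
    simpa only [map_smul] using h
  simp_rw [hφ, TensorProduct.tmul_sum]
  rw [Finset.sum_comm]
  refine Finset.sum_eq_zero fun j _ => ?_
  simp_rw [← TensorProduct.smul_tmul]
  rw [← TensorProduct.sum_tmul, hρπ, TensorProduct.zero_tmul]

lemma homUnit_surjective_of_homCounit_injective [IsLocalRing R] [Nontrivial C] [Module.Finite R H]
    (h : Function.Injective (homCounit R C (C ⊗[R] H))) : Function.Surjective (homUnit R C H) := by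
  have hs : Function.Surjective ((homUnit R C H).lTensor C) := fun y =>
    ⟨homCounit R C _ y, h (homCounit_lTensor_homUnit _)⟩
  have he := lTensor_exact C (LinearMap.exact_map_mkQ_range (homUnit R C H))
    (Submodule.mkQ_surjective _)
  have hsub : Subsingleton (C ⊗[R] ((C →ₗ[R] C ⊗[R] H) ⧸ LinearMap.range (homUnit R C H))) := by
    refine subsingleton_of_forall_eq 0 fun z => ?_
    obtain ⟨y, rfl⟩ := LinearMap.lTensor_surjective C (Submodule.mkQ_surjective _) z
    obtain ⟨x, rfl⟩ := hs y
    exact he.apply_apply_eq_zero x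
  rw [← LinearMap.range_eq_top, ← Submodule.Quotient.subsingleton_iff]
  by_contra hcon
  rw [not_subsingleton_iff_nontrivial] at hcon
  have := nontrivial_tensorProduct_of_isLocalRing (R := R) (A := C)
    (B := (C →ₗ[R] C ⊗[R] H) ⧸ LinearMap.range (homUnit R C H))
  exact not_subsingleton _ hsub

end Unit

section BaerFlat

variable {S : Type} [CommRing S] {A B U : Type} [AddCommGroup A] [Module S A]
  [AddCommGroup B] [Module S B] [AddCommGroup U] [Module S U]

lemma Module.Baer.exists_comp_eq_of_ker_le (hU : Module.Baer S U) (g : A →ₗ[S] B) (h : A →ₗ[S] U)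
    (hle : LinearMap.ker g ≤ LinearMap.ker h) : ∃ y : B →ₗ[S] U, y ∘ₗ g = h := by
  obtain ⟨y, hy⟩ := hU.extension_property ((LinearMap.ker g).liftQ g le_rfl)
    (LinearMap.ker_eq_bot.1 (Submodule.ker_liftQ_eq_bot' _ _ rfl)) ((LinearMap.ker g).liftQ h hle)
  refine ⟨y, ?_⟩
  ext a
  exact LinearMap.congr_fun hy (Submodule.Quotient.mk a)

/-- The endomorphism ring of an injective module over a Noetherian ring is flat. -/
lemma Module.Baer.flat_end [IsNoetherianRing S] (hU : Module.Baer S U) :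
    Module.Flat S (U →ₗ[S] U) := by
  refine Module.Flat.of_forall_isTrivialRelation fun {n f x} hx => ?_
  let F : (Fin n → S) →ₗ[S] S := Fintype.linearCombination S f
  have hF : ∀ v, F v = ∑ i, v i * f i := fun v => rfl
  obtain ⟨l, a, ha⟩ := Module.Finite.exists_fin' S (LinearMap.ker F)
  let α : Fin n → Fin l → S := fun i j => (a (Pi.single j 1) : Fin n → S) i
  have hα : ∀ w : Fin l → S, (a w : Fin n → S) = fun i => ∑ j, w j * α i j := by
    intro w
    conv_lhs => rw [pi_eq_sum_univ' w]
    ext i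
    simp [α]
  have hexact : ∀ u : Fin n → U, (∀ j, ∑ i, α i j • u i = 0) → ∃ z, ∀ i, u i = f i • z := by
    intro u hu
    obtain ⟨y, hy⟩ := hU.exists_comp_eq_of_ker_le F (Fintype.linearCombination S u) (by
      intro v hv
      obtain ⟨w, hw⟩ := ha ⟨v, hv⟩
      have hv' : v = fun i => ∑ j, w j * α i j := by rw [← hα, hw]
      rw [LinearMap.mem_ker, Fintype.linearCombination_apply, hv']
      simp_rw [Finset.sum_smul, mul_smul]
      rw [Finset.sum_comm]
      simp_rw [← Finset.smul_sum, hu, smul_zero, Finset.sum_const_zero])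
    refine ⟨y 1, fun i => ?_⟩
    have := LinearMap.congr_fun hy (Pi.single i 1)
    rw [← map_smul, smul_eq_mul, mul_one]
    simpa [hF, Pi.single_apply] using this.symm
  let g : (Fin n → U) →ₗ[S] (Fin l → U) :=
    LinearMap.pi fun j => ∑ i, α i j • LinearMap.proj i
  let h : (Fin n → U) →ₗ[S] U := ∑ i, x i ∘ₗ LinearMap.proj i
  obtain ⟨y, hy⟩ := hU.exists_comp_eq_of_ker_le g h (by
    intro u hu
    obtain ⟨z, hz⟩ := hexact u fun j => by simpa [g] using congrFun hu j
    have := LinearMap.congr_fun hx z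
    simpa [h, hz] using this)
  refine ⟨l, α, fun j => y ∘ₗ LinearMap.single S (fun _ => U) j, fun i => ?_, fun j => ?_⟩
  · ext u
    have := LinearMap.congr_fun hy (Pi.single i u)
    have hh : h (Pi.single i u) = x i u := by
      simp only [h, LinearMap.sum_apply, LinearMap.comp_apply, LinearMap.proj_apply]
      rw [Finset.sum_eq_single i (fun j _ hj => by simp [Pi.single_eq_of_ne hj]) (by simp)]
      simp
    have hg : g (Pi.single i u) = ∑ j, α i j • Pi.single j u := by
      ext j
      simp only [g, LinearMap.pi_apply, LinearMap.sum_apply, LinearMap.smul_apply,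
        LinearMap.proj_apply, Finset.sum_apply, Pi.smul_apply]
      rw [Finset.sum_eq_single i (fun j _ hj => by simp [Pi.single_eq_of_ne hj]) (by simp),
        Finset.sum_eq_single j (fun k _ hk => by simp [Pi.single_eq_of_ne hk.symm]) (by simp)]
      simp
    rw [← hh, ← this, LinearMap.comp_apply, hg]
    simp
  · have := (a (Pi.single j 1)).2
    rw [LinearMap.mem_ker, hF] at this
    simpa [mul_comm] using this

end BaerFlat

section EndFree

open IsLocalRing Pointwise

variable {R : Type} [CommRing R] {A B T U X X' : Type} [AddCommGroup A] [Module R A]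
  [AddCommGroup B] [Module R B] [AddCommGroup T] [Module R T] [AddCommGroup U] [Module R U]
  [AddCommGroup X] [Module R X] [AddCommGroup X'] [Module R X']

lemma exists_free_end_of_injective [IsNoetherianRing R] [IsLocalRing R] [Module.Finite R U]
    (I : Ideal R) (hI : I ≠ ⊤) (hIU : ∀ r ∈ I, ∀ u : U, r • u = 0)
    (hinj : ∀ (B B' : Type) [AddCommGroup B] [Module R B] [AddCommGroup B']
      [Module R B'] [Module.Finite R B] [Module.Finite R B'] (ι : B →ₗ[R] B'),
      Function.Injective ι → (∀ r ∈ I, ∀ b : B', r • b = 0) →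
      ∀ φ : B →ₗ[R] U, ∃ ψ : B' →ₗ[R] U, ψ ∘ₗ ι = φ) :
    ∃ q : ℕ, Nonempty ((U →ₗ[R] U) ≃ₗ[R] (Fin q → R ⧸ I)) := by
  have hT : Module.IsTorsionBySet R U (I : Set R) := fun u r => hIU r r.2 u
  let : Module (R ⧸ I) U := hT.module
  have : IsScalarTower R (R ⧸ I) U := hT.isScalarTower
  have hsurj : Function.Surjective (algebraMap R (R ⧸ I)) := Ideal.Quotient.mk_surjective
  have hbaer : Module.Baer (R ⧸ I) U := by
    intro J g
    have hfin : Module.Finite R J := inferInstanceAs (Module.Finite R (J.restrictScalars R))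
    obtain ⟨ψ, hψ⟩ := hinj J (R ⧸ I) (J.subtype.restrictScalars R) Subtype.val_injective
      (fun r hr b => by
        obtain ⟨b, rfl⟩ := Ideal.Quotient.mk_surjective b
        rw [← Ideal.Quotient.mk_eq_mk, ← Submodule.Quotient.mk_smul]
        exact (Submodule.Quotient.mk_eq_zero _).2 (I.mul_mem_right _ hr))
      (g.restrictScalars R)
    exact ⟨ψ.extendScalarsOfSurjective hsurj, fun x hx => LinearMap.congr_fun hψ ⟨x, hx⟩⟩
  have : Nontrivial (R ⧸ I) := Ideal.Quotient.nontrivial_iff.2 hI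
  have : IsLocalRing (R ⧸ I) := .of_surjective' _ hsurj
  have : Module.Finite (R ⧸ I) U := Module.Finite.of_restrictScalars_finite R _ _
  have := hbaer.flat_end
  have : Module.Free (R ⧸ I) (U →ₗ[R ⧸ I] U) := Module.free_of_flat_of_isLocalRing
  let e := (Module.finBasis (R ⧸ I) (U →ₗ[R ⧸ I] U)).equivFun
  exact ⟨_, ⟨(LinearMap.extendScalarsOfSurjectiveEquiv hsurj).trans (e.restrictScalars R)⟩⟩

lemma exists_linearMap_apply_eq {a : A} (ha : ∀ a', ∃ r : R, r • a = a') {v : X}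
    (hv : ∀ r : R, r • a = 0 → r • v = 0) : ∃ θ : A →ₗ[R] X, θ a = v := by
  let e := (LinearMap.toSpanSingleton R A a).quotKerEquivOfSurjective ha
  refine ⟨(LinearMap.ker (LinearMap.toSpanSingleton R A a)).liftQ
    (LinearMap.toSpanSingleton R X v) hv ∘ₗ e.symm.toLinearMap, ?_⟩
  have : e.symm a = Submodule.Quotient.mk 1 := by
    rw [LinearEquiv.symm_apply_eq]
    exact (one_smul R a).symm
  rw [LinearMap.comp_apply, LinearEquiv.coe_coe, this]
  exact one_smul R v

lemma exists_equiv_of_quotSMulTop [IsNoetherianRing R] [IsLocalRing R] [Module.Finite R A]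
    [Module.Finite R X] {a : A} (ha : ∀ a', ∃ r : R, r • a = a')
    (hX : ∀ r : R, r • a = 0 → ∀ y : X, r • y = 0) {x : R} (hx : x ∈ maximalIdeal R)
    {g : X →ₗ[R] X'} (hg : IsShortExact (LinearMap.lsmul R X x) g) {q : ℕ}
    (e : X' ≃ₗ[R] (Fin q → QuotSMulTop x A)) : Nonempty (X ≃ₗ[R] (Fin q → A)) := by
  choose v hv using fun i : Fin q => hg.surj
    (e.symm (Pi.single i ((x • (⊤ : Submodule R A)).mkQ a)))
  choose θ hθ using fun i => exists_linearMap_apply_eq ha (fun r hr => hX r hr (v i))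
  let φ : (Fin q → A) →ₗ[R] X := ∑ i, θ i ∘ₗ LinearMap.proj i
  have hφ : ∀ w, e (g (φ w)) = fun i => (x • (⊤ : Submodule R A)).mkQ (w i) := by
    suffices h : e.toLinearMap ∘ₗ g ∘ₗ φ =
        LinearMap.pi fun i => (x • (⊤ : Submodule R A)).mkQ ∘ₗ LinearMap.proj i from
      fun w => LinearMap.congr_fun h w
    refine LinearMap.pi_ext fun i a' => ?_
    obtain ⟨r, rfl⟩ := ha a'
    have h1 : φ (Pi.single i (r • a)) = r • v i := by
      simp only [φ, LinearMap.sum_apply, LinearMap.comp_apply, LinearMap.proj_apply]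
      rw [Finset.sum_eq_single i (fun j _ hj => by simp [Pi.single_eq_of_ne hj]) (by simp)]
      simp [hθ]
    ext j
    simp only [LinearMap.comp_apply, LinearEquiv.coe_coe, h1, map_smul, hv,
      LinearEquiv.apply_symm_apply, LinearMap.pi_apply, LinearMap.proj_apply]
    obtain rfl | hij := eq_or_ne j i
    · simp
    · simp [Pi.single_eq_of_ne hij]
  have hreg : IsSMulRegular X x := hg.inj
  have hsurj : Function.Surjective φ := by
    rw [← LinearMap.range_eq_top, eq_top_iff]
    refine Submodule.le_of_le_smul_of_le_jacobson_bot (I := maximalIdeal R)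
      (Module.finite_def.1 inferInstance) (maximalIdeal_le_jacobson _) fun y _ => ?_
    choose w hw using fun i => (x • (⊤ : Submodule R A)).mkQ_surjective (e (g y) i)
    have hgy : g (y - φ w) = 0 := by
      apply e.injective
      rw [map_sub, map_sub, hφ, map_zero, sub_eq_zero]
      ext i
      exact (hw i).symm
    obtain ⟨z, hz⟩ := (hg.exact _).1 hgy
    rw [← sub_add_cancel y (φ w), add_comm]
    refine Submodule.add_mem_sup ⟨w, rfl⟩ ?_
    rw [← hz]
    exact Submodule.smul_mem_smul hx trivial
  have hker : LinearMap.ker φ = ⊥ := by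
    refine Submodule.eq_bot_of_le_smul_of_le_jacobson_bot (maximalIdeal R) _
      (IsNoetherian.noetherian _) (fun w hw => ?_) (maximalIdeal_le_jacobson _)
    have hw' : ∀ i, w i ∈ x • (⊤ : Submodule R A) := fun i => by
      have := congrFun (hφ w) i
      rw [LinearMap.mem_ker.1 hw, map_zero, map_zero] at this
      exact (Submodule.Quotient.mk_eq_zero _).1 this.symm
    choose z _ hz using hw'
    have hwz : w = x • z := funext fun i => (hz i).symm
    rw [hwz]
    refine Submodule.smul_mem_smul hx (hreg ?_)
    change x • φ z = x • 0
    rw [← map_smul, ← hwz, hw, smul_zero]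
  exact ⟨(LinearEquiv.ofBijective φ ⟨LinearMap.ker_eq_bot.1 hker, hsurj⟩).symm⟩

end EndFree

section EndFreeInduction

open IsLocalRing Pointwise

variable {R : Type} [CommRing R] {A B T U : Type} [AddCommGroup A] [Module R A]
  [AddCommGroup B] [Module R B] [AddCommGroup T] [Module R T] [AddCommGroup U] [Module R U]

variable [IsNoetherianRing R] [IsLocalRing R]

lemma DepthGE.extVanish_of_pow_smul_eq_zero [Module.Finite R B] {s : ℕ} (h : DepthGE R s U)
    (hB : ∃ k, ∀ r ∈ maximalIdeal R ^ k, ∀ b : B, r • b = 0) {i : ℕ} (hi : i < s) :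
    ExtVanish R B U i := by
  obtain ⟨k, hk⟩ := hB
  induction ‹Module.Finite R B› using
    IsNoetherianRing.induction_on_isQuotientEquivQuotientPrime R with
  | subsingleton N => exact extVanish_of_subsingleton_left i
  | quotient N p e =>
    refine ExtVanish.of_equiv_left ?_ e
    have hle : maximalIdeal R ≤ p.1 := by
      refine p.2.le_of_pow_le (n := k) fun r hr => ?_
      have := hk r hr (e.symm (Ideal.Quotient.mk p.1 1))
      rw [← map_smul, LinearEquiv.map_eq_zero_iff] at this
      rw [← Ideal.Quotient.eq_zero_iff_mem]
      simpa [Algebra.smul_def] using this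
    rw [le_antisymm (le_maximalIdeal p.2.ne_top) hle]
    exact h i hi
  | exact N₁ N₂ N₃ f g hf hg hfg h₁ h₃ =>
    refine IsShortExact.extVanish_contra_two ⟨hf, hg, hfg⟩ i (h₁ fun r hr b => hf ?_)
      (h₃ fun r hr b => ?_)
    · rw [map_smul, hk r hr, map_zero]
    · obtain ⟨b, rfl⟩ := hg b
      rw [← map_smul, hk r hr, map_zero]

/-- Elements of `Ext^s(B, U)` extend along injections `B → B'` of finite length modules
killed by the annihilator of `a`. -/
def ExtExtends (R : Type) [CommRing R] [IsLocalRing R] {A : Type} [AddCommGroup A] [Module R A]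
    (a : A) (U : Type) [AddCommGroup U] [Module R U] (s : ℕ) : Prop :=
  ∀ (B B' : Type) [AddCommGroup B] [Module R B] [AddCommGroup B'] [Module R B'],
    Module.Finite R B → Module.Finite R B' → ∀ ι : B →ₗ[R] B', Function.Injective ι →
    (∀ r : R, r • a = 0 → ∀ b : B', r • b = 0) →
    (∃ k, ∀ r ∈ maximalIdeal R ^ k, ∀ b : B', r • b = 0) →
    ∀ y : Abelian.Ext (ModuleCat.of R B) (ModuleCat.of R U) s,
      ∃ z : Abelian.Ext (ModuleCat.of R B') (ModuleCat.of R U) s,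
        (Abelian.Ext.mk₀ (ModuleCat.ofHom ι)).comp z (zero_add s) = y

lemma ExtExtends.quotSMulTop {a : A} {s : ℕ} (h : ExtExtends R a U (s + 1)) {x : R}
    (hU : DepthGE R (s + 1) U) (hx : IsSMulRegular U x) :
    ExtExtends R ((x • (⊤ : Submodule R A)).mkQ a) (QuotSMulTop x U) s := by
  intro B B' _ _ _ _ _ _ ι hι hann hk y
  have hse := IsShortExact.quotSMulTop hx
  have hB : ∃ k, ∀ r ∈ maximalIdeal R ^ k, ∀ b : B, r • b = 0 := by
    obtain ⟨k, hk⟩ := hk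
    exact ⟨k, fun r hr b => hι (by rw [map_smul, hk r hr, map_zero])⟩
  have hxB : ∀ b : B', x • b = 0 := hann x (by
    rw [← map_smul]
    exact (Submodule.Quotient.mk_eq_zero _).2 (Submodule.smul_mem_pointwise_smul _ _ _ trivial))
  obtain ⟨z, hz⟩ := h B B' ‹_› ‹_› ι hι (fun r hr => hann r (by rw [← map_smul, hr, map_zero])) hk
    (y.comp hse.extClass rfl)
  obtain ⟨w, rfl⟩ := hse.covariant_one z (comp_mk₀_lsmul_eq_zero hxB z)
  refine ⟨w, ?_⟩
  rw [← sub_eq_zero]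
  obtain ⟨v, hv⟩ := hse.covariant_three
    ((Abelian.Ext.mk₀ (ModuleCat.ofHom ι)).comp w (zero_add s) - y) (by
      rw [sub_eq_add_neg, Abelian.Ext.add_comp, Abelian.Ext.neg_comp, ← hz, ← sub_eq_add_neg,
        sub_eq_zero]
      exact Abelian.Ext.comp_assoc _ _ _ _ _ (by omega))
  have := hU.extVanish_of_pow_smul_eq_zero hB (Nat.lt_succ_self s)
  rw [← hv, this.elim v 0, Abelian.Ext.zero_comp]

lemma exists_linearMap_equiv_pi_of_supportDim_nonpos [Module.Finite R A] [Nontrivial A]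
    [Module.Finite R U] {a : A} (ha : ∀ a', ∃ r : R, r • a = a')
    (hU : ∀ r : R, r • a = 0 → ∀ z : U, r • z = 0) {u : T →ₗ[R] U} (hu : Function.Surjective u)
    (hker : LinearMap.ker u ≤ LinearMap.ker (LinearMap.toSpanSingleton R A a) • ⊤)
    (hA : Module.supportDim R A ≤ 0) (hext : ExtExtends R a U 0) :
    ∃ q : ℕ, Nonempty ((T →ₗ[R] U) ≃ₗ[R] (Fin q → A)) := by
  let I : Ideal R := LinearMap.ker (LinearMap.toSpanSingleton R A a)
  have hI : ∀ {r : R}, r ∈ I ↔ r • a = 0 := Iff.rfl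
  let e := (LinearMap.toSpanSingleton R A a).quotKerEquivOfSurjective ha
  have hpow : ∃ k, maximalIdeal R ^ k ≤ I := by
    have h0 : Module.supportDim R A = 0 := le_antisymm hA DepthGE.zero.le_supportDim
    have hsupp := support_of_supportDim_eq_zero R A h0
    rw [Module.support_eq_zeroLocus] at hsupp
    obtain ⟨k, hk⟩ := Ideal.exists_pow_le_of_le_radical_of_fg
      ((PrimeSpectrum.zeroLocus_subset_zeroLocus_iff _ _).1 hsupp.le)
      (IsNoetherian.noetherian _)
    exact ⟨k, hk.trans fun r hr => Module.mem_annihilator.1 hr a⟩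
  have hItop : I ≠ ⊤ := fun h => by
    have : (1 : R) • a = 0 := hI.1 (h ▸ trivial)
    obtain ⟨b, hb⟩ := exists_ne (0 : A)
    obtain ⟨r, rfl⟩ := ha b
    simp_all
  obtain ⟨q, ⟨E⟩⟩ := exists_free_end_of_injective I hItop hU (fun B B' _ _ _ _ _ _ ι hι hann φ => by
    obtain ⟨k, hk⟩ := hpow
    obtain ⟨z, hz⟩ := hext B B' ‹_› ‹_› ι hι hann ⟨k, fun r hr => hann r (hk hr)⟩
      (Abelian.Ext.mk₀ (ModuleCat.ofHom φ))
    obtain ⟨ψ, rfl⟩ := (Abelian.Ext.mk₀_bijective _ _).2 z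
    refine ⟨ψ.hom, ?_⟩
    rw [Abelian.Ext.mk₀_comp_mk₀] at hz
    exact congrArg ModuleCat.Hom.hom ((Abelian.Ext.mk₀_bijective _ _).1 hz))
  have hbij : Function.Bijective (u.lcomp R U) := by
    refine ⟨lcomp_injective hu, fun φ => ?_⟩
    have hle : LinearMap.ker u ≤ LinearMap.ker φ := hker.trans (Submodule.smul_le.2
      fun r hr t _ => by rw [LinearMap.mem_ker, map_smul, hU r (hI.1 hr)])
    exact ⟨(LinearMap.ker u).liftQ φ hle ∘ₗ (u.quotKerEquivOfSurjective hu).symm.toLinearMap, by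
      ext t
      have : (u.quotKerEquivOfSurjective hu).symm (u t) = Submodule.Quotient.mk t := by
        rw [LinearEquiv.symm_apply_eq]; rfl
      simp [this]⟩
  exact ⟨q, ⟨(LinearEquiv.ofBijective _ hbij).symm.trans
    (E.trans (LinearEquiv.piCongrRight fun _ => e))⟩⟩

lemma exists_linearMap_equiv_pi [Module.Finite R T] {s : ℕ} :
    ∀ {A U : Type} [AddCommGroup A] [Module R A] [AddCommGroup U] [Module R U]
      [Module.Finite R A] [Nontrivial A] [Module.Finite R U] {a : A} {u : T →ₗ[R] U},
      (∀ a', ∃ r : R, r • a = a') → (∀ r : R, r • a = 0 → ∀ z : U, r • z = 0) →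
      Function.Surjective u →
      LinearMap.ker u ≤ LinearMap.ker (LinearMap.toSpanSingleton R A a) • ⊤ →
      Module.supportDim R A ≤ s → DepthGE R s A → DepthGE R s U →
      (∀ i, ExtVanish R T U (i + 1)) → ExtExtends R a U s →
      ∃ q : ℕ, Nonempty ((T →ₗ[R] U) ≃ₗ[R] (Fin q → A)) := by
  induction s with
  | zero =>
    exact fun ha hU hu hker hA _ _ _ hext =>
      exists_linearMap_equiv_pi_of_supportDim_nonpos ha hU hu hker hA hext
  | succ s ih =>
    intro A U _ _ _ _ _ _ _ a u ha hU hu hker hdim hA hdU hV hext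
    obtain ⟨x, hx, hreg⟩ := DepthGE.exists_regular (A := A × U)
      (fun i hi => (hA i hi).prod_right (hdU i hi))
    have hrA : IsSMulRegular A x := fun b c hbc =>
      congrArg Prod.fst (@hreg (b, 0) (c, 0) (Prod.ext hbc rfl))
    have hrU : IsSMulRegular U x := fun b c hbc =>
      congrArg Prod.snd (@hreg (0, b) (0, c) (Prod.ext rfl hbc))
    have hsA := IsShortExact.quotSMulTop hrA
    have hsU := IsShortExact.quotSMulTop hrU
    have := nontrivial_quotSMulTop_of_mem_maximalIdeal A hx
    have hxa : x • (x • (⊤ : Submodule R A)).mkQ a = 0 := by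
      rw [← map_smul]
      exact (Submodule.Quotient.mk_eq_zero _).2 (Submodule.smul_mem_pointwise_smul _ _ _ trivial)
    have hxT : ∀ t : T, x • t ∈ LinearMap.ker (LinearMap.toSpanSingleton R (QuotSMulTop x A)
        ((x • (⊤ : Submodule R A)).mkQ a)) • (⊤ : Submodule R T) :=
      fun t => Submodule.smul_mem_smul hxa trivial
    obtain ⟨q, ⟨e⟩⟩ := ih (A := QuotSMulTop x A) (U := QuotSMulTop x U)
      (a := (x • (⊤ : Submodule R A)).mkQ a) (u := (x • (⊤ : Submodule R U)).mkQ ∘ₗ u)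
      (fun a' => by
        obtain ⟨a', rfl⟩ := Submodule.mkQ_surjective _ a'
        obtain ⟨r, rfl⟩ := ha a'
        exact ⟨r, (map_smul _ _ _).symm⟩)
      (fun r hr z => by
        obtain ⟨z, rfl⟩ := Submodule.mkQ_surjective _ z
        rw [← map_smul] at hr ⊢
        obtain ⟨b, -, hb⟩ := (Submodule.Quotient.mk_eq_zero _).1 hr
        obtain ⟨c, rfl⟩ := ha b
        refine (Submodule.Quotient.mk_eq_zero _).2 ?_
        have := hU (r - x * c) (by rw [sub_smul, mul_smul, sub_eq_zero]; exact hb.symm) z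
        rw [sub_smul, sub_eq_zero, mul_smul] at this
        rw [this]
        exact Submodule.smul_mem_pointwise_smul _ _ _ trivial)
      ((Submodule.mkQ_surjective _).comp hu)
      (fun t ht => by
        obtain ⟨z, -, hz⟩ := (Submodule.Quotient.mk_eq_zero _).1 (LinearMap.mem_ker.1 ht)
        obtain ⟨t', rfl⟩ := hu z
        have hmem : t - x • t' ∈ LinearMap.ker u := by
          rw [LinearMap.mem_ker, map_sub, map_smul, sub_eq_zero]
          exact hz.symm
        rw [← sub_add_cancel t (x • t')]
        refine add_mem (Submodule.smul_mono_left (fun r hr => ?_) (hker hmem)) (hxT t')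
        change r • (x • (⊤ : Submodule R A)).mkQ a = 0
        rw [← map_smul, show r • a = 0 from hr, map_zero])
      (by
        rw [← Module.supportDim_quotSMulTop_succ_eq_supportDim hrA hx] at hdim
        push_cast at hdim
        exact ENat.WithBot.add_le_add_one_right_iff.1 hdim)
      (DepthGE.right hsA hA (hA.mono (by omega)))
      (DepthGE.right hsU hdU (hdU.mono (by omega)))
      (fun i => hsU.extVanish_cov_three _ (hV i) (hV (i + 1)))
      (hext.quotSMulTop hdU hrU)
    have hse := hsU.llcomp (M := T) (hV 0)
    exact ⟨q, exists_equiv_of_quotSMulTop ha (fun r hr φ => by ext t; exact hU r hr _) hx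
      (X := T →ₗ[R] U) (g := (x • (⊤ : Submodule R U)).mkQ.compRight R) hse e⟩

/-- The endomorphism module of a maximal Cohen-Macaulay module of finite injective dimension
is free. -/
lemma exists_end_equiv_pi [Module.Finite R T] {d : ℕ} (hd : ringKrullDim R = d)
    (hR : DepthGE R d R) (hT : DepthGE R d T) (hinj : InjDimLE R d T) :
    ∃ q : ℕ, Nonempty ((T →ₗ[R] T) ≃ₗ[R] (Fin q → R)) := by
  refine exists_linearMap_equiv_pi (s := d) (a := (1 : R)) (u := LinearMap.id)
    (fun r => ⟨r, by simp⟩) (fun r hr z => ?_) Function.surjective_id (by simp)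
    (by rw [Module.supportDim_self_eq_ringKrullDim, hd]) hR hT
    (fun i => hinj.extVanish_of_depthGE hT _ (by omega)) ?_
  · rw [smul_eq_mul, mul_one] at hr
    rw [hr, zero_smul]
  · intro B B' _ _ _ _ _ _ ι hι _ _ y
    exact (IsShortExact.mkQ_range ι hι).contravariant_one y
      ((hinj _ inferInstance _ (by omega)).elim _ _)

end EndFreeInduction

section CohenMacaulay

open IsLocalRing TensorProduct

variable {R : Type} [CommRing R] {C H M N T : Type} [AddCommGroup C] [Module R C]
  [AddCommGroup H] [Module R H] [AddCommGroup M] [Module R M] [AddCommGroup N] [Module R N]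
  [AddCommGroup T] [Module R T]

lemma annihilator_eq_bot_of_lsmul_injective (hC : Function.Injective (LinearMap.lsmul R C)) :
    Module.annihilator R C = ⊥ := by
  refine (Submodule.eq_bot_iff _).2 fun r hr => hC ?_
  rw [map_zero]
  ext c
  exact Module.mem_annihilator.1 hr c

lemma nontrivial_of_lsmul_injective [Nontrivial R]
    (hC : Function.Injective (LinearMap.lsmul R C)) : Nontrivial C := by
  by_contra h
  rw [not_nontrivial_iff_subsingleton] at h
  exact one_ne_zero (α := R) (hC (by ext; exact Subsingleton.elim _ _))

variable [IsNoetherianRing R] [IsLocalRing R] [Module.Finite R C]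

lemma DepthGE.of_bijective_lsmul (hC : Function.Bijective (LinearMap.lsmul R C))
    (hCC : ∀ i, ExtVanish R C C (i + 1)) {t : ℕ} (h : DepthGE R t R) : DepthGE R t C :=
  DepthGE.of_hom (annihilator_eq_bot_of_lsmul_injective hC.1) hCC
    (h.of_equiv (LinearEquiv.ofBijective _ hC).symm)

/-- If `C ⊗ H` has finite injective dimension and `H` is maximal Cohen-Macaulay with injective
unit map, then `R` is Cohen-Macaulay. -/
lemma depthGE_of_injDimLE_tensorProduct {d n : ℕ} (hd : ringKrullDim R = d)
    (hC : Function.Bijective (LinearMap.lsmul R C)) (hCC : ∀ i, ExtVanish R C C (i + 1))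
    [Module.Finite R H] [Nontrivial H] (hH : Function.Injective (homUnit R C H))
    (hHd : DepthGE R d H) (hinj : InjDimLE R n (C ⊗[R] H)) :
    DepthGE R d R ∧ ¬ ExtVanish R (R ⧸ maximalIdeal R) R d ∧ InjDimLE R d (C ⊗[R] H) ∧
      DepthGE R d (C ⊗[R] H) ∧ (∀ i, ExtVanish R C (C ⊗[R] H) (i + 1)) ∧
      Function.Surjective (homUnit R C H) := by
  obtain ⟨t, htd, ht, ht'⟩ := exists_depthGE_not_extVanish hd
  have hT := hinj.le_depth ht ht'
  have hCT : ∀ i, ExtVanish R C (C ⊗[R] H) (i + 1) := fun i =>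
    hT.extVanish_of_depthGE (ht.of_bijective_lsmul hC hCC) _ (by omega)
  have := nontrivial_of_lsmul_injective hC.1
  have hsurj := homUnit_surjective_of_homCounit_injective
    (homCounit_injective (T := C ⊗[R] H) hC.2 hCC hT hCT)
  have hTd : DepthGE R d (C ⊗[R] H) :=
    DepthGE.of_hom (annihilator_eq_bot_of_lsmul_injective hC.1) hCT
      (hHd.of_equiv (LinearEquiv.ofBijective _ ⟨hH, hsurj⟩).symm)
  obtain rfl : t = d := by
    by_contra hne
    have hlt : DepthGE R (d + 1) (C ⊗[R] H) := fun i hi => by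
      obtain h | h := lt_or_ge i d
      · exact hTd i h
      · exact hT _ inferInstance _ (by omega)
    have := nontrivial_tensorProduct_of_isLocalRing (R := R) (A := C) (B := H)
    have hle := hlt.le_supportDim.trans (Module.supportDim_le_ringKrullDim R _)
    rw [hd] at hle
    have : d + 1 ≤ d := by exact_mod_cast hle
    omega
  exact ⟨ht, ht', hT, hTd, hCT, hsurj⟩

end CohenMacaulay

section Retraction

open IsLocalRing TensorProduct

variable {R : Type} [CommRing R] {C H N P : Type} [AddCommGroup C] [Module R C]
  [AddCommGroup H] [Module R H] [AddCommGroup N] [Module R N] [AddCommGroup P] [Module R P]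

lemma lTensor_sum_comp_eq_id {b : ℕ} {ev : Fin b → P →ₗ[R] N} {κ : Fin b → N →ₗ[R] P}
    (h : ∑ i, κ i ∘ₗ ev i = LinearMap.id) (y : C ⊗[R] P) :
    ∑ i, (κ i).lTensor C ((ev i).lTensor C y) = y := by
  induction y with
  | zero => simp
  | tmul c p =>
    simp only [LinearMap.lTensor_tmul, ← TensorProduct.tmul_sum]
    congr 1
    simpa using LinearMap.congr_fun h p
  | add x y hx hy =>
    simp only [map_add, Finset.sum_add_distrib, hx, hy]

lemma homUnit_surjective_of_sum_comp_eq_id (hN : Function.Surjective (homUnit R C N)) {b : ℕ}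
    {ev : Fin b → P →ₗ[R] N} {κ : Fin b → N →ₗ[R] P} (h : ∑ i, κ i ∘ₗ ev i = LinearMap.id) :
    Function.Surjective (homUnit R C P) := by
  intro f
  choose n hn using fun i => hN ((ev i).lTensor C ∘ₗ f)
  refine ⟨∑ i, κ i (n i), ?_⟩
  ext c
  rw [← lTensor_sum_comp_eq_id h (f c), map_sum, LinearMap.sum_apply]
  refine Finset.sum_congr rfl fun i _ => ?_
  exact congrArg ((κ i).lTensor C) (LinearMap.congr_fun (hn i) c)

lemma extVanish_tensorProduct_of_sum_comp_eq_id {i : ℕ} (hN : ExtVanish R C (C ⊗[R] N) i) {b : ℕ}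
    {ev : Fin b → P →ₗ[R] N} {κ : Fin b → N →ₗ[R] P} (h : ∑ i, κ i ∘ₗ ev i = LinearMap.id) :
    ExtVanish R C (C ⊗[R] P) i := by
  refine (hN.pi_right b).retract_right (LinearMap.pi fun j => (ev j).lTensor C)
    (∑ j, (κ j).lTensor C ∘ₗ LinearMap.proj j) ?_
  refine LinearMap.ext fun y => ?_
  simpa using lTensor_sum_comp_eq_id h y

variable [IsNoetherianRing R] [IsLocalRing R] [Module.Finite R C]

lemma exists_retraction_lTensor {d : ℕ}
    (hC : Function.Injective (LinearMap.lsmul R C)) [Module.Finite R H] [Module.Finite R P]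
    (hH : Function.Surjective (homUnit R C H)) (hP : Function.Bijective (homUnit R C P))
    (hCH : ∀ i, ExtVanish R C (C ⊗[R] H) (i + 1)) (hCP : ∀ i, ExtVanish R C (C ⊗[R] P) (i + 1))
    (hinj : InjDimLE R d (C ⊗[R] H)) {ι : H →ₗ[R] P} (hι : Function.Injective ι)
    (hcoker : DepthGE R d (P ⧸ LinearMap.range ι)) :
    ∃ w : C ⊗[R] P →ₗ[R] C ⊗[R] H, w ∘ₗ ι.lTensor C = LinearMap.id := by
  have hann := annihilator_eq_bot_of_lsmul_injective hC
  have hτ : Function.Injective (ι.lTensor C) := by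
    rw [← LinearMap.ker_eq_bot, ← Submodule.subsingleton_iff_eq_bot]
    refine subsingleton_of_subsingleton_hom hann (subsingleton_of_forall_eq 0 fun f => ?_)
    obtain ⟨h, hh⟩ := hH ((LinearMap.ker (ι.lTensor C)).subtype ∘ₗ f)
    have : homUnit R C P (ι h) = 0 := by
      ext c
      have := congrArg (ι.lTensor C) (LinearMap.congr_fun hh c)
      exact this.trans (f c).2
    rw [← map_zero (homUnit R C P)] at this
    have h0 := hι ((hP.1 this).trans (map_zero ι).symm)
    rw [h0, map_zero] at hh
    ext c
    exact (LinearMap.congr_fun hh c).symm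
  have hse := IsShortExact.mkQ_range _ hτ
  have hCZ : ∀ i, ExtVanish R C (C ⊗[R] P ⧸ LinearMap.range (ι.lTensor C)) (i + 1) := fun i =>
    hse.extVanish_cov_three _ (hCP i) (hCH (i + 1))
  have hse' := hse.llcomp (M := C) (hCH 0)
  let γ : P →ₗ[R] C →ₗ[R] (C ⊗[R] P ⧸ LinearMap.range (ι.lTensor C)) :=
    (LinearMap.range (ι.lTensor C)).mkQ.compRight R ∘ₗ homUnit R C P
  have hγ : Function.Surjective γ := hse'.surj.comp hP.2
  have hker : LinearMap.ker γ = LinearMap.range ι := by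
    ext p
    constructor
    · intro hp
      obtain ⟨f, hf⟩ := (hse'.exact _).1 hp
      obtain ⟨h, rfl⟩ := hH f
      exact ⟨h, hP.1 hf⟩
    · rintro ⟨h, rfl⟩
      exact (hse'.exact _).2 ⟨homUnit R C H h, rfl⟩
  have hZ : DepthGE R d (C ⊗[R] P ⧸ LinearMap.range (ι.lTensor C)) :=
    DepthGE.of_hom hann hCZ (hcoker.of_equiv ((γ.quotKerEquivOfSurjective hγ).symm.trans
      (Submodule.quotEquivOfEq _ _ hker)))
  exact hse.exists_extension (hinj.extVanish_of_depthGE hZ 1 (by omega)) _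

end Retraction

section FreeSummand

open IsLocalRing TensorProduct

variable {R : Type} [CommRing R] {C M N T : Type} [AddCommGroup C] [Module R C]
  [AddCommGroup M] [Module R M] [AddCommGroup N] [Module R N]
  [AddCommGroup T] [Module R T]

variable [IsLocalRing R]

lemma exists_isUnit_apply_id [Module.Finite R T] [Nontrivial T] {q : ℕ}
    (E : (T →ₗ[R] T) ≃ₗ[R] (Fin q → R)) : ∃ j, IsUnit (E LinearMap.id j) := by
  by_contra! hcon
  refine not_subsingleton T (subsingleton_of_forall_eq 0 fun t => ?_)
  have htop : (⊤ : Submodule R T) ≤ maximalIdeal R • ⊤ := fun t _ => by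
    have h := LinearMap.congr_fun (E.symm_apply_apply LinearMap.id) t
    rw [pi_eq_sum_univ' (E LinearMap.id), map_sum, LinearMap.sum_apply] at h
    rw [← LinearMap.id_apply (R := R) t, ← h]
    refine Submodule.sum_mem _ fun j _ => ?_
    rw [map_smul, LinearMap.smul_apply]
    exact Submodule.smul_mem_smul (hcon j) trivial
  have := Submodule.eq_bot_of_le_smul_of_le_jacobson_bot _ _ Module.Finite.fg_top htop
    (maximalIdeal_le_jacobson _)
  exact (Submodule.mem_bot R).1 (this ▸ Submodule.mem_top)

variable [IsNoetherianRing R] [Module.Finite R C] [Module.Finite R M] [Module.Finite R N]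

/-- If `C ⊗ Hom(M, N)` has finite injective dimension, then `R` is Cohen-Macaulay, `M` has a free
summand and `N` is faithful. -/
lemma exists_free_summand_of_injDimLE {d n : ℕ} (hd : ringKrullDim R = d)
    (hC : Function.Bijective (LinearMap.lsmul R C)) (hCC : ∀ i, ExtVanish R C C (i + 1))
    (hN : Function.Bijective (homUnit R C N)) (hCN : ∀ i, ExtVanish R C (C ⊗[R] N) (i + 1))
    (hNd : DepthGE R d N) [Nontrivial (M →ₗ[R] N)]
    (hinj : InjDimLE R n (C ⊗[R] (M →ₗ[R] N)))
    (hV : ∀ i, 1 ≤ i → i + 1 ≤ d → ExtVanish R M N i) :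
    DepthGE R d R ∧ ¬ ExtVanish R (R ⧸ maximalIdeal R) R d ∧ Module.annihilator R N = ⊥ ∧
      ∃ (f : M →ₗ[R] R) (u : M), f u = 1 := by
  have := nontrivial_of_lsmul_injective hC.1
  have hHi := homUnit_hom_injective (M := M) hN.1
  obtain ⟨hR, hR', hTd, hTD, hCT, hHs⟩ := depthGE_of_injDimLE_tensorProduct hd hC hCC hHi
    (DepthGE.hom hNd fun i hi his => hV i hi (by omega)) hinj
  have := nontrivial_tensorProduct_of_isLocalRing (R := R) (A := C) (B := M →ₗ[R] N)
  obtain ⟨q, ⟨E⟩⟩ := exists_end_equiv_pi hd hR hTD hTd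
  obtain ⟨j, hj⟩ := exists_isUnit_apply_id E
  refine ⟨hR, hR', ?_, ?_⟩
  · refine (Submodule.eq_bot_iff _).2 fun r hr => ?_
    have hrT : r • (LinearMap.id : C ⊗[R] (M →ₗ[R] N) →ₗ[R] C ⊗[R] (M →ₗ[R] N)) = 0 := by
      have hrH : r • (LinearMap.id : (M →ₗ[R] N) →ₗ[R] (M →ₗ[R] N)) = 0 := by
        ext φ m
        exact Module.mem_annihilator.1 hr _
      rw [← LinearMap.lTensor_id, ← LinearMap.lTensor_smul, hrH, LinearMap.lTensor_zero]
    have h := congrFun (congrArg E hrT) j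
    rw [map_smul, map_zero, Pi.smul_apply, Pi.zero_apply, smul_eq_mul] at h
    exact (hj.mul_left_eq_zero).1 h
  obtain ⟨b, π, hπ⟩ := Module.Finite.exists_fin' R M
  let ev : Fin b → ((Fin b → R) →ₗ[R] N) →ₗ[R] N := fun i => LinearMap.applyₗ (Pi.single i 1)
  let κ : Fin b → N →ₗ[R] ((Fin b → R) →ₗ[R] N) := fun i =>
    (LinearMap.lsmul R N ∘ₗ LinearMap.proj i).flip
  have hid : ∑ i, κ i ∘ₗ ev i = LinearMap.id := by
    refine LinearMap.ext fun φ => LinearMap.ext fun x => ?_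
    conv_rhs => rw [LinearMap.id_apply, pi_eq_sum_univ' x, map_sum]
    simp [κ, ev]
  obtain ⟨w, hw⟩ := exists_retraction_lTensor hC.1 hHs
    ⟨homUnit_hom_injective hN.1, homUnit_surjective_of_sum_comp_eq_id hN.2 hid⟩ hCT
    (fun i => extVanish_tensorProduct_of_sum_comp_eq_id (hCN i) hid) hTd
    (lcomp_injective hπ) (DepthGE.cokernel_lcomp hNd hπ hV)
  let L : Fin b → M →ₗ[R] R := fun i => LinearMap.proj j ∘ₗ E.toLinearMap ∘ₗ
    (LinearMap.compRight R (w ∘ₗ (κ i).lTensor C)) ∘ₗ (LinearMap.lTensorHom C) ∘ₗ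
      LinearMap.applyₗ
  have hsum : E LinearMap.id j = ∑ i, L i (π (Pi.single i 1)) := by
    have h1 : (LinearMap.id : C ⊗[R] (M →ₗ[R] N) →ₗ[R] C ⊗[R] (M →ₗ[R] N)) =
        ∑ i, (w ∘ₗ (κ i).lTensor C) ∘ₗ
          (LinearMap.applyₗ (R := R) (M₂ := N) (π (Pi.single i 1))).lTensor C := by
      rw [← hw]
      refine LinearMap.ext fun y => ?_
      rw [LinearMap.comp_apply, ← lTensor_sum_comp_eq_id hid ((π.lcomp R N).lTensor C y), map_sum,
        LinearMap.sum_apply]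
      refine Finset.sum_congr rfl fun i _ => ?_
      exact congrArg (fun z => w ((κ i).lTensor C z))
        (LinearMap.lTensor_comp_apply C (ev i) (π.lcomp R N) y).symm
    rw [h1, map_sum, Finset.sum_apply]
    rfl
  obtain ⟨i, hi⟩ : ∃ i, IsUnit (L i (π (Pi.single i 1))) := by
    by_contra! hcon
    rw [hsum] at hj
    exact (mem_maximalIdeal _).1 (Submodule.sum_mem _ fun i _ => hcon i) hj
  obtain ⟨v, hv⟩ := hi.exists_left_inv
  exact ⟨L i, v • π (Pi.single i 1), by rw [map_smul, smul_eq_mul, hv]⟩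

end FreeSummand

section Decomposition

open IsLocalRing TensorProduct

variable {R : Type} [CommRing R] {C M N P : Type} [AddCommGroup C] [Module R C]
  [AddCommGroup M] [Module R M] [AddCommGroup N] [Module R N] [AddCommGroup P] [Module R P]

/-- A split surjection decomposes its source as kernel times target. -/
def equivKerProd {f : M →ₗ[R] P} {s : P →ₗ[R] M} (h : f ∘ₗ s = LinearMap.id) :
    M ≃ₗ[R] (LinearMap.ker f × P) where
  toFun m := (⟨m - s (f m), by simpa [sub_eq_zero] using (LinearMap.congr_fun h (f m)).symm⟩, f m)
  map_add' x y := by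
    ext
    · simp only [map_add, Prod.fst_add, Submodule.coe_add]
      abel
    · simp
  map_smul' r x := by
    ext
    · simp [smul_sub]
    · simp
  invFun p := p.1 + s p.2
  left_inv m := by simp
  right_inv p := by
    have hp : f p.1 = 0 := p.1.2
    have hs : f (s p.2) = p.2 := LinearMap.congr_fun h p.2
    ext <;> simp [hs, hp]

lemma exists_ker_retraction [Module.Projective R P] {f : M →ₗ[R] P} (hf : Function.Surjective f) :
    ∃ (ρ : M →ₗ[R] LinearMap.ker f) (s : P →ₗ[R] M), ρ ∘ₗ (LinearMap.ker f).subtype = LinearMap.id ∧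
      ρ ∘ₗ s = 0 ∧ f ∘ₗ s = LinearMap.id := by
  obtain ⟨s, hs⟩ := Module.projective_lifting_property f LinearMap.id hf
  refine ⟨LinearMap.fst R _ _ ∘ₗ (equivKerProd hs).toLinearMap, s, ?_, ?_, hs⟩
  · ext x
    simp [equivKerProd]
  · ext x
    have : f (s x) = x := LinearMap.congr_fun hs x
    simp [equivKerProd, this]

lemma InjDimLE.lTensor_retract {A B : Type} [AddCommGroup A] [Module R A] [AddCommGroup B]
    [Module R B] {n : ℕ} (h : InjDimLE R n (C ⊗[R] B)) (s : A →ₗ[R] B) (r : B →ₗ[R] A)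
    (hrs : r ∘ₗ s = LinearMap.id) : InjDimLE R n (C ⊗[R] A) := fun X _ _ hX j hj =>
  (h X hX j hj).retract_right (s.lTensor C) (r.lTensor C) (by
    rw [← LinearMap.lTensor_comp, hrs, LinearMap.lTensor_id])

lemma HasFiniteInjDim.lTensor_retract {A B : Type} [AddCommGroup A] [Module R A] [AddCommGroup B]
    [Module R B] (h : HasFiniteInjDim R (C ⊗[R] B)) (s : A →ₗ[R] B) (r : B →ₗ[R] A)
    (hrs : r ∘ₗ s = LinearMap.id) : HasFiniteInjDim R (C ⊗[R] A) := by
  obtain ⟨n, hn⟩ := h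
  refine ⟨n, fun X _ _ j hj => (subsingleton_extMod_iff j).2 ?_⟩
  refine ((subsingleton_extMod_iff j).1 (hn X j hj)).retract_right (s.lTensor C) (r.lTensor C) ?_
  rw [← LinearMap.lTensor_comp, hrs, LinearMap.lTensor_id]

variable [IsLocalRing R]

lemma mem_mTorsion_iff {x : M} :
    x ∈ mTorsion R M ↔ ∃ n : ℕ, ∀ a ∈ maximalIdeal R ^ n, a • x = 0 := by
  have hmono : Monotone fun n : ℕ => Submodule.torsionBySet R M
      ((maximalIdeal R ^ n : Ideal R) : Set R) := fun i j hij =>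
    Submodule.torsionBySet_le_torsionBySet_of_subset (Ideal.pow_le_pow_right hij)
  rw [mTorsion, Submodule.mem_iSup_of_directed _ hmono.directed_le]
  simp [Submodule.mem_torsionBySet_iff]

lemma nonempty_equiv_mTorsion_prod {r k : ℕ} {f : M →ₗ[R] (Fin r → R)} (hf : Function.Surjective f)
    (hk : maximalIdeal R ^ k ≤ Module.annihilator R (LinearMap.ker f))
    (h : ∀ x ∈ mTorsion R M, f x = 0) :
    Nonempty (M ≃ₗ[R] (mTorsion R M × (Fin r → R))) := by
  have heq : mTorsion R M = LinearMap.ker f := le_antisymm h fun x hx =>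
    mem_mTorsion_iff.2 ⟨k, fun a ha =>
      congrArg Subtype.val (Module.mem_annihilator.1 (hk ha) ⟨x, hx⟩)⟩
  rw [heq]
  obtain ⟨s, hs⟩ := Module.projective_lifting_property f LinearMap.id hf
  exact ⟨equivKerProd hs⟩

variable [IsNoetherianRing R]

lemma eq_zero_of_mem_mTorsion (hR : DepthGE R 1 R) {r : ℕ} {f : M →ₗ[R] (Fin r → R)} {x : M}
    (hx : x ∈ mTorsion R M) : f x = 0 := by
  obtain ⟨n, hn⟩ := mem_mTorsion_iff.1 hx
  obtain ⟨y, hy, hreg⟩ := DepthGE.exists_regular hR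
  have h := congrArg f (hn (y ^ n) (Ideal.pow_mem_pow hy n))
  rw [map_smul, map_zero] at h
  ext i
  refine (hreg.pow n) ?_
  simpa using congrFun h i

variable [Module.Finite R M]

lemma eq_maximalIdeal_of_extVanish {s : ℕ} : ∀ {L : Type} [AddCommGroup L] [Module R L]
    [Module.Finite R L], (∀ i < s, ExtVanish R M L i) → Module.supportDim R L ≤ s →
    ∀ p ∈ Module.support R L, Module.annihilator R M ≤ p.asIdeal → maximalIdeal R ≤ p.asIdeal := by
  induction s with
  | zero =>
    intro L _ _ _ _ hL p hp _
    have : Nontrivial L := by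
      by_contra h
      rw [not_nontrivial_iff_subsingleton] at h
      rw [Module.support_eq_empty] at hp
      exact hp
    have h0 : Module.supportDim R L = 0 := le_antisymm hL DepthGE.zero.le_supportDim
    rw [support_of_supportDim_eq_zero R L h0] at hp
    exact hp
  | succ s ih =>
    intro L _ _ _ hV hL p hp hM
    obtain ⟨x, hx, hr⟩ := IsSMulRegular.subsingleton_linearMap_iff.1
      (extVanish_zero_iff.1 (hV 0 (by omega)))
    have hxm : x ∈ maximalIdeal R := le_maximalIdeal p.2.ne_top (hM hx)
    refine ih (L := QuotSMulTop x L) (fun i hi => (IsShortExact.quotSMulTop hr).extVanish_cov_three i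
      (hV i (by omega)) (hV (i + 1) (by omega))) ?_ p ?_ hM
    · rw [← Module.supportDim_quotSMulTop_succ_eq_supportDim hr hxm] at hL
      push_cast at hL
      exact ENat.WithBot.add_le_add_one_right_iff.1 hL
    · rw [Module.support_quotSMulTop]
      exact ⟨hp, by simpa using hM hx⟩

variable [Module.Finite R N]

lemma exists_pow_le_annihilator_of_extVanish {s : ℕ} (hN : Module.annihilator R N = ⊥)
    (hd : ringKrullDim R = s) (hV : ∀ i < s, ExtVanish R M N i) :
    ∃ k, maximalIdeal R ^ k ≤ Module.annihilator R M := by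
  refine Ideal.exists_pow_le_of_le_radical_of_fg
    ((PrimeSpectrum.zeroLocus_subset_zeroLocus_iff _ _).1 fun p hp => ?_)
    (IsNoetherian.noetherian _)
  refine eq_maximalIdeal_of_extVanish hV (hd ▸ Module.supportDim_le_ringKrullDim R N) p ?_ hp
  rw [Module.support_eq_zeroLocus, hN]
  simp

variable [Module.Finite R C]

lemma exists_surjective_subsingleton_ker_hom {d n : ℕ} (hd : ringKrullDim R = d)
    (hC : Function.Bijective (LinearMap.lsmul R C)) (hCC : ∀ i, ExtVanish R C C (i + 1))
    (hN : Function.Bijective (homUnit R C N)) (hCN : ∀ i, ExtVanish R C (C ⊗[R] N) (i + 1))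
    (hNd : DepthGE R d N) (hinj : InjDimLE R n (C ⊗[R] (M →ₗ[R] N)))
    (hV : ∀ i, 1 ≤ i → i + 1 ≤ d → ExtVanish R M N i) :
    ∃ (r : ℕ) (f : M →ₗ[R] (Fin r → R)), Function.Surjective f ∧
      ∀ i < d, ExtVanish R (LinearMap.ker f) N i := by
  obtain ⟨b, π, hπ⟩ := Module.Finite.exists_fin' R M
  let S : Set ℕ := {r | ∃ f : M →ₗ[R] (Fin r → R), Function.Surjective f}
  have hbdd : BddAbove S := ⟨b, fun r ⟨f, hf⟩ => le_of_fin_surjective R (f ∘ₗ π) (hf.comp hπ)⟩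
  have hne : S.Nonempty := ⟨0, 0, fun x => ⟨0, Subsingleton.elim _ _⟩⟩
  obtain ⟨f, hf⟩ := Nat.sSup_mem hne hbdd
  refine ⟨_, f, hf, ?_⟩
  obtain ⟨ρ, s, hρ, hρs, hs⟩ := exists_ker_retraction hf
  have hV' : ∀ i, 1 ≤ i → i + 1 ≤ d → ExtVanish R (LinearMap.ker f) N i := fun i h h' =>
    (hV i h h').retract_left _ _ hρ
  obtain hsub | hnt := subsingleton_or_nontrivial (LinearMap.ker f →ₗ[R] N)
  · intro i hi
    obtain rfl | h := Nat.eq_zero_or_pos i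
    · exact extVanish_zero_iff.2 hsub
    · exact hV' i h hi
  exfalso
  obtain ⟨-, -, -, g, u, hgu⟩ := exists_free_summand_of_injDimLE hd hC hCC hN hCN hNd
    (hinj.lTensor_retract (ρ.lcomp R N) ((LinearMap.ker f).subtype.lcomp R N) (by
      refine LinearMap.ext fun φ => LinearMap.ext fun x => ?_
      exact congrArg φ (LinearMap.congr_fun hρ x))) hV'
  have hmem : sSup S + 1 ∈ S := by
    refine ⟨(Fin.consLinearEquiv R fun _ => R).toLinearMap ∘ₗ (g ∘ₗ ρ).prod f,
      (Fin.consLinearEquiv R fun _ => R).surjective.comp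
        (f := ((g ∘ₗ ρ).prod f)) fun p => ?_⟩
    refine ⟨(p.1 • u : LinearMap.ker f) + s p.2, ?_⟩
    have h1 : f (p.1 • u : LinearMap.ker f) = 0 := (p.1 • u).2
    have h2 : ρ (p.1 • u : LinearMap.ker f) = p.1 • u := LinearMap.congr_fun hρ (p.1 • u)
    have h3 : ρ (s p.2) = 0 := LinearMap.congr_fun hρs _
    have h4 : f (s p.2) = p.2 := LinearMap.congr_fun hs _
    ext1
    · simp only [LinearMap.prod_apply, Function.prod_apply, LinearMap.comp_apply, map_add, h2, h3,
        map_smul, hgu]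
      simp
    · exact (map_add f _ _).trans (by rw [h1, h4, zero_add])
  exact absurd (le_csSup hbdd hmem) (by omega)

end Decomposition

theorem cm_and_decomposition_of_finite_C_injdim_hom
    (R : Type) [CommRing R] [IsNoetherianRing R] [IsLocalRing R]
    (d : ℕ) (hd : ringKrullDim R = d)
    (C : Type) [AddCommGroup C] [Module R C] [Module.Finite R C]
    (hC : IsSemidualizing R C)
    (M N : Type) [AddCommGroup M] [Module R M] [AddCommGroup N] [Module R N]
    [Module.Finite R M] [Module.Finite R N]
    (hN : MemAuslanderClass R C N) (hNmcm : moduleDepth R N = d)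
    (hhom : Nontrivial (M →ₗ[R] N))
    (hCinj : HasFiniteInjDim R (TensorProduct R C (M →ₗ[R] N)))
    (hext : ∀ i : ℕ, 1 ≤ i → i ≤ d - 1 → Subsingleton (extMod R i M N)) :
    moduleDepth R R = d ∧ HasFiniteInjDim R (TensorProduct R C N) ∧
      ∃ r : ℕ, Nonempty (M ≃ₗ[R] (↥(mTorsion R M) × (Fin r → R))) := by
  have hCC : ∀ i, ExtVanish R C C (i + 1) := fun i =>
    (subsingleton_extMod_iff _).1 (hC.ext_vanish _ (by omega))
  have hCN : ∀ i, ExtVanish R C (TensorProduct R C N) (i + 1) := fun i =>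
    (subsingleton_extMod_iff _).1 (hN.ext_vanish _ (by omega))
  have hNd := depthGE_of_moduleDepth_eq hNmcm
  have hV : ∀ i, 1 ≤ i → i + 1 ≤ d → ExtVanish R M N i := fun i h h' =>
    (subsingleton_extMod_iff _).1 (hext i h (by omega))
  obtain ⟨n, hn⟩ := id hCinj
  have hinj : InjDimLE R n (TensorProduct R C (M →ₗ[R] N)) := fun B _ _ _ j hj =>
    (subsingleton_extMod_iff _).1 (hn B j hj)
  obtain ⟨hR, hR', hann, g, u, hgu⟩ :=
    exists_free_summand_of_injDimLE hd hC.bijective hCC hN.bijective hCN hNd hinj hV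
  refine ⟨moduleDepth_eq_of_depthGE hR hR',
    hCinj.lTensor_retract (LinearMap.lsmul R N ∘ₗ g).flip (LinearMap.applyₗ u) ?_, ?_⟩
  · ext x
    simp [hgu]
  obtain rfl | hpos := Nat.eq_zero_or_pos d
  · obtain ⟨k, hk⟩ := exists_pow_le_annihilator_of_extVanish (M := M) hann hd (by simp)
    refine ⟨0, nonempty_equiv_mTorsion_prod (k := k) (f := 0)
      (fun x => ⟨0, Subsingleton.elim _ _⟩) (hk.trans ?_) fun x _ => rfl⟩
    exact LinearMap.annihilator_le_of_injective _ (Submodule.injective_subtype _)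
  · obtain ⟨r, f, hf, hker⟩ :=
      exists_surjective_subsingleton_ker_hom hd hC.bijective hCC hN.bijective hCN hNd hinj hV
    obtain ⟨k, hk⟩ := exists_pow_le_annihilator_of_extVanish hann hd hker
    exact ⟨r, nonempty_equiv_mTorsion_prod hf hk fun x hx =>
      eq_zero_of_mem_mTorsion (hR.mono hpos) hx⟩
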